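/- arXiv:hep-th/0301162 — 10 statements merged into one kernel-verified Lean document; each statement's English description precedes it below -/
import Mathlib

section
/- If [a_1, …, a_r] and [b_1, …, b_s] are nonempty lists of integers with every a_i ≥ 2 and every b_j ≥ 2, and their Hirzebruch–Jung continued fraction values are equal, then the two lists are equal (in particular r = s). -/
/-- The Hirzebruch–Jung continued fraction value of a list of integers:
`[[a]] = a` and `[[a₁, …, a_r]] = a₁ - 1 / [[a₂, …, a_r]]`. -/
def hjValue : List ℤ → ℚ
  | [] => 0
  | [a] => (a : ℚ)
  | a :: b :: rest => (a : ℚ) - 1 / hjValue (b :: rest)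

theorem hjValue_cons (a : ℤ) (l : List ℤ) : hjValue (a :: l) = a - (hjValue l)⁻¹ := by
  cases l <;> simp [hjValue]

theorem one_lt_hjValue {l : List ℤ} (hl : l ≠ []) (h : ∀ a ∈ l, 2 ≤ a) : 1 < hjValue l := by
  induction l with
  | nil => exact absurd rfl hl
  | cons a t ih =>
    have ha : (2 : ℚ) ≤ a := by exact_mod_cast h a List.mem_cons_self
    rw [hjValue_cons]
    rcases eq_or_ne t [] with rfl | ht
    · simp only [hjValue, inv_zero]
      linarith
    · have := inv_lt_one_of_one_lt₀ (ih ht fun b hb => h b (List.mem_cons_of_mem a hb))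
      linarith

theorem hjValue_inv_mem_Ico {l : List ℤ} (h : ∀ a ∈ l, 2 ≤ a) :
    (hjValue l)⁻¹ ∈ Set.Ico (0 : ℚ) 1 := by
  rcases eq_or_ne l [] with rfl | hl
  · simp [hjValue]
  · have h_one := one_lt_hjValue hl h
    exact ⟨inv_nonneg.2 (by linarith), inv_lt_one_of_one_lt₀ h_one⟩

theorem ceil_hjValue_cons (a : ℤ) {l : List ℤ} (h : ∀ b ∈ l, 2 ≤ b) :
    ⌈hjValue (a :: l)⌉ = a := by
  obtain ⟨h_nonneg, h_lt⟩ := hjValue_inv_mem_Ico h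
  rw [hjValue_cons, Int.ceil_eq_iff]
  constructor <;> linarith

theorem eq_of_hjValue_eq {l₁ l₂ : List ℤ} (ha₁ : ∀ a ∈ l₁, 2 ≤ a) (ha₂ : ∀ a ∈ l₂, 2 ≤ a)
    (hval : hjValue l₁ = hjValue l₂) : l₁ = l₂ := by
  induction l₁ generalizing l₂ with
  | nil =>
    by_contra hne
    have h_one := one_lt_hjValue (Ne.symm hne) ha₂
    rw [← hval, hjValue] at h_one
    linarith
  | cons a t₁ ih =>
    cases l₂ with
    | nil =>
      have h_one := one_lt_hjValue (List.cons_ne_nil a t₁) ha₁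
      rw [hval, hjValue] at h_one
      linarith
    | cons b t₂ =>
      have ht₁ : ∀ c ∈ t₁, 2 ≤ c := fun c hc => ha₁ c (List.mem_cons_of_mem a hc)
      have ht₂ : ∀ c ∈ t₂, 2 ≤ c := fun c hc => ha₂ c (List.mem_cons_of_mem b hc)
      obtain rfl : a = b := by
        rw [← ceil_hjValue_cons a ht₁, hval, ceil_hjValue_cons b ht₂]
      rw [hjValue_cons, hjValue_cons, sub_right_inj, inv_inj] at hval
      rw [ih ht₁ ht₂ hval]

/-- Uniqueness of Hirzebruch–Jung expansions: two nonempty lists of integers, each with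
all entries at least `2`, having the same Hirzebruch–Jung continued fraction value
must be equal (in particular they have the same length). -/
theorem hj_expansion_unique (l₁ l₂ : List ℤ) (h₁ : l₁ ≠ []) (h₂ : l₂ ≠ [])
    (ha₁ : ∀ a ∈ l₁, 2 ≤ a) (ha₂ : ∀ a ∈ l₂, 2 ≤ a)
    (hval : hjValue l₁ = hjValue l₂) :
    l₁ = l₂ :=
  eq_of_hjValue_eq ha₁ ha₂ hval
end

section
/- Let n > k ≥ 1 be integers with gcd(n,k) = 1, and let [a_1, …, a_r] be a nonempty list of integers with every a_i ≥ 2 whose Hirzebruch–Jung continued fraction value equals n/k. Define vectors v_j ∈ ℤ² by v_0 = (0,1), v_1 = (1,0), and v_{j+1} = a_j·v_j − v_{j−1} for 1 ≤ j ≤ r. Then v_{r+1} = (n, −k). (This is the toric relation a_j v_j = v_{j−1} + v_{j+1} for the lattice vectors of the fan resolving ℂ²/ℤ_{n(k)}, whose boundary rays are v_0 = (0,1) and (n,−k).) -/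
/-- The numerator and denominator of `[[a₁, …, a_r]]`, computed by the convergent recursion,
with `(1, 0)` for the empty list. -/
def hjPair : List ℤ → ℤ × ℤ
  | [] => (1, 0)
  | a :: l => (a * (hjPair l).1 - (hjPair l).2, (hjPair l).1)

theorem hjPair_bounds (l : List ℤ) (ha : ∀ a ∈ l, 2 ≤ a) :
    0 ≤ (hjPair l).2 ∧ (hjPair l).2 < (hjPair l).1 := by
  induction l with
  | nil => simp [hjPair]
  | cons a l ih =>
    obtain ⟨h0, h1⟩ := ih fun b hb => ha b (List.mem_cons_of_mem _ hb)
    have h2 : 2 ≤ a := ha a List.mem_cons_self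
    simp only [hjPair]
    constructor <;> nlinarith

theorem hjPair_isCoprime (l : List ℤ) : IsCoprime (hjPair l).1 (hjPair l).2 := by
  induction l with
  | nil => exact isCoprime_one_left
  | cons a l ih =>
    obtain ⟨x, y, h⟩ := ih
    exact ⟨-y, x + a * y, by simp only [hjPair]; linear_combination h⟩

theorem hjValue_eq_hjPair_div (l : List ℤ) (hl : l ≠ []) (ha : ∀ a ∈ l, 2 ≤ a) :
    hjValue l = ((hjPair l).1 : ℚ) / ((hjPair l).2 : ℚ) := by
  induction l with
  | nil => exact absurd rfl hl
  | cons a l ih =>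
    have ha' : ∀ b ∈ l, 2 ≤ b := fun b hb => ha b (List.mem_cons_of_mem _ hb)
    obtain ⟨h0, h1⟩ := hjPair_bounds l ha'
    have hp : ((hjPair l).1 : ℚ) ≠ 0 := by exact_mod_cast (h0.trans_lt h1).ne'
    cases l with
    | nil => simp [hjValue, hjPair]
    | cons b l =>
      rw [hjValue, ih (List.cons_ne_nil _ _) ha', hjPair.eq_2 a (b :: l), one_div_div]
      push_cast
      field_simp

/-- The last vector of a sequence satisfying the toric relation, in terms of the first two. -/
theorem toric_recurrence_last {M : Type*} [AddCommGroup M] (l : List ℤ) (v : ℕ → M)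
    (hrec : ∀ j : ℕ, 1 ≤ j → j ≤ l.length →
      v (j + 1) = (l.getD (j - 1) 0) • v j - v (j - 1)) :
    v (l.length + 1) = (hjPair l).1 • v 1 - (hjPair l).2 • v 0 := by
  induction l generalizing v with
  | nil => simp [hjPair]
  | cons a l ih =>
    have h2 : v 2 = a • v 1 - v 0 := by simpa using hrec 1 le_rfl (by simp)
    have h := ih (fun j => v (j + 1)) fun j hj hjl => by
      obtain ⟨i, rfl⟩ := Nat.exists_eq_add_of_le' hj
      simpa using hrec (i + 1 + 1) (by simp) (by simpa using hjl)
    simp only [zero_add, Nat.reduceAdd, h2] at h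
    rw [List.length_cons, h, hjPair]
    module

/-- Let `n > k ≥ 1` with `gcd(n,k) = 1`, and let `[a₁, …, a_r]` be a nonempty list of
integers with all entries at least `2` whose Hirzebruch–Jung continued fraction value is
`n/k`.  Define lattice vectors `v_j ∈ ℤ²` by `v₀ = (0,1)`, `v₁ = (1,0)` and the toric
relation `v_{j+1} = a_j • v_j - v_{j-1}` for `1 ≤ j ≤ r` (so `a_j v_j = v_{j-1} + v_{j+1}`).
Then `v_{r+1} = (n, -k)`: these are the lattice vectors of the fan resolving
`ℂ²/ℤ_{n(k)}`, whose boundary rays are `v₀ = (0,1)` and `(n,-k)`. -/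
theorem hj_toric_vectors (n k : ℤ) (hk : 1 ≤ k) (hnk : k < n) (hgcd : Int.gcd n k = 1)
    (l : List ℤ) (hl : l ≠ []) (ha : ∀ a ∈ l, 2 ≤ a)
    (hval : hjValue l = (n : ℚ) / (k : ℚ))
    (v : ℕ → ℤ × ℤ) (hv0 : v 0 = (0, 1)) (hv1 : v 1 = (1, 0))
    (hrec : ∀ j : ℕ, 1 ≤ j → j ≤ l.length →
      v (j + 1) = (l.getD (j - 1) 0) • v j - v (j - 1)) :
    v (l.length + 1) = (n, -k) := by
  obtain ⟨p0, p1⟩ := hjPair_bounds l ha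
  rw [hjValue_eq_hjPair_div l hl ha] at hval
  have hq : 0 < (hjPair l).2 := by
    refine p0.lt_of_ne fun h => ?_
    have hpos : (0 : ℚ) < n / k :=
      div_pos (by exact_mod_cast (by omega : 0 < n)) (by exact_mod_cast (by omega : 0 < k))
    rw [← hval, ← h] at hpos
    simp at hpos
  obtain ⟨hn, hd⟩ := Rat.div_int_inj hq (by omega)
    (Int.isCoprime_iff_gcd_eq_one.mp (hjPair_isCoprime l)) hgcd hval
  rw [toric_recurrence_last l v hrec, hv0, hv1, hn, hd]
  simp
end

section
/- The subgroup of SL(2,ℂ) generated by S and U (the binary octahedral group E_7) has exactly 48 elements. -/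
open Complex Matrix

/-- If the right cosets `K * w i` are distinct and permuted by right multiplication by the
elements of `X`, then they partition the subgroup generated by `X`. -/
lemma card_closure_eq_card_mul_card {G ι : Type*} [Group G] [Finite ι] {X : Set G}
    {K : Subgroup G} {w : ι → G} (hK : K ≤ Subgroup.closure X)
    (hw : ∀ i, w i ∈ Subgroup.closure X) (hone : ∃ i, w i = 1)
    (hmul : ∀ x ∈ X, ∀ i, ∃ j, w i * x * (w j)⁻¹ ∈ K)
    (hinj : ∀ i j, w i * (w j)⁻¹ ∈ K → i = j) :
    Nat.card (Subgroup.closure X) = Nat.card K * Nat.card ι := by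
  have hinv : ∀ x ∈ X, ∀ j, ∃ i, w j * x⁻¹ * (w i)⁻¹ ∈ K := by
    intro x hx
    choose f hf using hmul x hx
    have hf_inj : Function.Injective f := by
      intro i i' h
      apply hinj
      have := K.mul_mem (hf i) (K.inv_mem (hf i'))
      rw [h] at this
      simpa [mul_assoc] using this
    intro j
    obtain ⟨i, rfl⟩ := Finite.surjective_of_injective hf_inj j
    exact ⟨i, by simpa [mul_assoc] using K.inv_mem (hf i)⟩
  have hcover : ∀ g ∈ Subgroup.closure X, ∃ i, g * (w i)⁻¹ ∈ K := by
    intro g hg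
    induction hg using Subgroup.closure_induction_right with
    | one =>
      obtain ⟨i, hi⟩ := hone
      exact ⟨i, by simp [hi]⟩
    | mul_right g _ x hx ih =>
      obtain ⟨i, hi⟩ := ih
      obtain ⟨j, hj⟩ := hmul x hx i
      exact ⟨j, by simpa [mul_assoc] using K.mul_mem hi hj⟩
    | mul_inv_cancel g _ x hx ih =>
      obtain ⟨i, hi⟩ := ih
      obtain ⟨j, hj⟩ := hinv x hx i
      exact ⟨j, by simpa [mul_assoc] using K.mul_mem hi hj⟩
  rw [← Nat.card_prod]
  refine (Nat.card_congr (Equiv.ofBijective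
    (fun p : K × ι => (⟨p.1 * w p.2, mul_mem (hK p.1.2) (hw p.2)⟩ : Subgroup.closure X))
    ⟨?_, ?_⟩)).symm
  · rintro ⟨⟨k, hk⟩, i⟩ ⟨⟨l, hl⟩, j⟩ h
    have h : k * w i = l * w j := congrArg Subtype.val h
    obtain rfl : i = j := by
      apply hinj
      have : w i * (w j)⁻¹ = k⁻¹ * l := by
        rw [mul_inv_eq_iff_eq_mul, mul_assoc, ← h, inv_mul_cancel_left]
      exact this ▸ K.mul_mem (K.inv_mem hk) hl
    simpa using h
  · rintro ⟨g, hg⟩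
    obtain ⟨i, hi⟩ := hcover g hg
    exact ⟨(⟨_, hi⟩, i), by simp⟩

/-- `diag(e^{iπ/4}, e^{-iπ/4})` squares to `diag(i, -i)`. -/
lemma octahedral_sq {U : Matrix.SpecialLinearGroup (Fin 2) ℂ} {c : ℂ} (hc : c ^ 2 = 1 / 2)
    (hU : (U : Matrix (Fin 2) (Fin 2) ℂ) = c • !![1 + I, 0; 0, 1 - I]) :
    ((U ^ 2 : Matrix.SpecialLinearGroup (Fin 2) ℂ) : Matrix (Fin 2) (Fin 2) ℂ) =
      !![I, 0; 0, -I] := by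
  have hI : I ^ 2 = -1 := I_sq
  rw [pow_two, Matrix.SpecialLinearGroup.coe_mul, hU]
  ext i j
  fin_cases i <;> fin_cases j <;>
    simp [-Matrix.SpecialLinearGroup.coe_pow, mul_apply, Fin.sum_univ_two] <;> grind

lemma octahedral_pow_four {U : Matrix.SpecialLinearGroup (Fin 2) ℂ} {c : ℂ} (hc : c ^ 2 = 1 / 2)
    (hU : (U : Matrix (Fin 2) (Fin 2) ℂ) = c • !![1 + I, 0; 0, 1 - I]) :
    U ^ 4 = -1 := by
  have hU2 := octahedral_sq hc hU
  refine Subtype.ext (?_ : (_ : Matrix _ _ _) = _)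
  rw [show U ^ 4 = U ^ 2 * U ^ 2 by group, Matrix.SpecialLinearGroup.coe_mul, hU2]
  ext i j
  fin_cases i <;> fin_cases j <;> simp

/-- The multiplication rules that rewrite words in `S` and `U` as `U ^ k` times one of
`1`, `S`, `S * U`, `S * U ^ 2`, `S * U ^ 3`, `S * U * S`. -/
lemma octahedral_relations {S U : Matrix.SpecialLinearGroup (Fin 2) ℂ} {c : ℂ}
    (hc : c ^ 2 = 1 / 2)
    (hS : (S : Matrix (Fin 2) (Fin 2) ℂ) = (1 / 2 : ℂ) • !![-1 + I, -1 + I; 1 + I, -1 - I])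
    (hU : (U : Matrix (Fin 2) (Fin 2) ℂ) = c • !![1 + I, 0; 0, 1 - I]) :
    S * U ^ 3 * S = U ∧
    S * U ^ 2 * S = U ^ 4 * U * (S * U) ∧
    S * S = U ^ 4 * U ^ 2 * U * (S * U ^ 3) ∧
    S * U * S * U = U ^ 4 * U ^ 2 * U * (S * U * S) ∧
    S * U * S * S = U ^ 2 * U * (S * U ^ 2) := by
  have hI : I ^ 2 = -1 := I_sq
  have hU2 := octahedral_sq hc hU
  have hU4 := octahedral_pow_four hc hU
  refine ⟨?_, ?_, ?_, ?_, ?_⟩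
  · refine Subtype.ext (?_ : (_ : Matrix _ _ _) = _)
    rw [show U ^ 3 = U ^ 2 * U by group]
    simp only [Matrix.SpecialLinearGroup.coe_mul, hU2, hU, hS]
    ext i j
    fin_cases i <;> fin_cases j <;>
    simp [-Matrix.SpecialLinearGroup.coe_pow, mul_apply, Fin.sum_univ_two] <;> grind
  · refine Subtype.ext (?_ : (_ : Matrix _ _ _) = _)
    rw [hU4]
    simp only [Matrix.SpecialLinearGroup.coe_mul, hU2, hU, hS, Matrix.SpecialLinearGroup.coe_neg,
      Matrix.SpecialLinearGroup.coe_one]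
    ext i j
    fin_cases i <;> fin_cases j <;>
    simp [-Matrix.SpecialLinearGroup.coe_pow, mul_apply, Fin.sum_univ_two] <;> grind
  · refine Subtype.ext (?_ : (_ : Matrix _ _ _) = _)
    rw [hU4, show U ^ 3 = U ^ 2 * U by group]
    simp only [Matrix.SpecialLinearGroup.coe_mul, hU2, hU, hS, Matrix.SpecialLinearGroup.coe_neg,
      Matrix.SpecialLinearGroup.coe_one]
    ext i j
    fin_cases i <;> fin_cases j <;>
    simp [-Matrix.SpecialLinearGroup.coe_pow, mul_apply, Fin.sum_univ_two] <;> grind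
  · refine Subtype.ext (?_ : (_ : Matrix _ _ _) = _)
    rw [hU4]
    simp only [Matrix.SpecialLinearGroup.coe_mul, hU2, hU, hS, Matrix.SpecialLinearGroup.coe_neg,
      Matrix.SpecialLinearGroup.coe_one]
    ext i j
    fin_cases i <;> fin_cases j <;>
    simp [-Matrix.SpecialLinearGroup.coe_pow, mul_apply, Fin.sum_univ_two] <;> grind
  · refine Subtype.ext (?_ : (_ : Matrix _ _ _) = _)
    simp only [Matrix.SpecialLinearGroup.coe_mul, hU2, hU, hS]
    ext i j
    fin_cases i <;> fin_cases j <;>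
    simp [-Matrix.SpecialLinearGroup.coe_pow, mul_apply, Fin.sum_univ_two] <;> grind

/-- The vertices `∞, 1, -i, -1, i, 0` of the octahedron, in homogeneous coordinates. -/
def octahedronVertex : Fin 6 → Fin 2 → ℂ :=
  ![![1, 0], ![1, 1], ![1, -I], ![1, -1], ![1, I], ![0, 1]]

/-- Words in `S` and `U` whose first rows are proportional to the vertices of the octahedron. -/
def octahedralWord {G : Type*} [Monoid G] (S U : G) : Fin 6 → G :=
  ![1, S, S * U, S * U ^ 2, S * U ^ 3, S * U * S]

lemma eq_of_octahedronVertex_proportional {i j : Fin 6}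
    (h : octahedronVertex i 1 * octahedronVertex j 0 -
      octahedronVertex i 0 * octahedronVertex j 1 = 0) : i = j := by
  revert h
  fin_cases i <;> fin_cases j <;> simp [octahedronVertex, Complex.ext_iff] <;> norm_num

lemma octahedralWord_first_row {S U : Matrix.SpecialLinearGroup (Fin 2) ℂ} {c : ℂ}
    (hc : c ^ 2 = 1 / 2)
    (hS : (S : Matrix (Fin 2) (Fin 2) ℂ) = (1 / 2 : ℂ) • !![-1 + I, -1 + I; 1 + I, -1 - I])
    (hU : (U : Matrix (Fin 2) (Fin 2) ℂ) = c • !![1 + I, 0; 0, 1 - I])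
    (i : Fin 6) : ∃ t : ℂ, t ≠ 0 ∧
      (octahedralWord S U i).1 0 = t • octahedronVertex i := by
  have hI : I ^ 2 = -1 := I_sq
  fin_cases i
  · exact ⟨1, one_ne_zero, by ext k; fin_cases k <;> simp [octahedralWord, octahedronVertex]⟩
  · refine ⟨(-1 + I) / 2, by grind, ?_⟩
    ext k
    fin_cases k <;> simp [octahedralWord, octahedronVertex, hS] <;> ring
  · refine ⟨-c, by grind, ?_⟩
    ext k
    fin_cases k <;>
      simp [octahedralWord, octahedronVertex, hS, hU, mul_apply, Fin.sum_univ_two] <;>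
      grind
  · refine ⟨(-1 - I) / 2, by grind, ?_⟩
    ext k
    fin_cases k <;>
      simp [octahedralWord, octahedronVertex, hS, hU, pow_two, mul_apply, Fin.sum_univ_two] <;>
      grind
  · refine ⟨-I * c, by grind, ?_⟩
    ext k
    fin_cases k <;>
      simp [octahedralWord, octahedronVertex, hS, hU, pow_succ, mul_apply, Fin.sum_univ_two] <;>
      grind
  · refine ⟨c * (1 - I), by grind, ?_⟩
    ext k
    fin_cases k <;>
      simp [octahedralWord, octahedronVertex, hS, hU, mul_apply, Fin.sum_univ_two] <;>
      grind

/-- The binary octahedral group `E₇ ⊂ SL(2,ℂ)`, generated by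
`S = ½[[-1+i, -1+i],[1+i, -1-i]]` and `U = (1/√2)[[1+i,0],[0,1-i]]`, has exactly 48
elements. -/
theorem binary_octahedral_card (S U : Matrix.SpecialLinearGroup (Fin 2) ℂ)
    (hS : (S : Matrix (Fin 2) (Fin 2) ℂ) =
      (1 / 2 : ℂ) • !![-1 + Complex.I, -1 + Complex.I; 1 + Complex.I, -1 - Complex.I])
    (hU : (U : Matrix (Fin 2) (Fin 2) ℂ) =
      ((Real.sqrt 2 : ℂ))⁻¹ • !![1 + Complex.I, 0; 0, 1 - Complex.I]) :
    Nat.card (Subgroup.closure ({S, U} : Set (Matrix.SpecialLinearGroup (Fin 2) ℂ))) = 48 := by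
  obtain ⟨c, hc⟩ : ∃ c : ℂ, c = ((Real.sqrt 2 : ℂ))⁻¹ := ⟨_, rfl⟩
  have hc2 : c ^ 2 = 1 / 2 := by
    rw [hc, inv_pow, ← ofReal_pow, Real.sq_sqrt (by norm_num)]
    norm_num
  rw [← hc] at hU
  have hU2 := octahedral_sq hc2 hU
  have hU4 := octahedral_pow_four hc2 hU
  obtain ⟨hSUUUS, hSUUS, hSS, hSUSU, hSUSS⟩ := octahedral_relations hc2 hS hU
  have hSUUUU : S * U ^ 3 * U = U ^ 4 * S := by
    rw [mul_assoc, ← pow_succ, hU4, mul_neg_one, neg_one_mul]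
  have horder : orderOf U = 8 := by
    refine orderOf_eq_prime_pow (p := 2) (n := 2) ?_ ?_
    · intro h
      have h := congrArg (fun g : Matrix.SpecialLinearGroup (Fin 2) ℂ => g 0 0) (hU4.symm.trans h)
      norm_num at h
    · rw [show 2 ^ (2 + 1) = 4 * 2 by norm_num, pow_mul, hU4, neg_one_sq]
  have hdiag : ∀ g ∈ Subgroup.zpowers U, g 0 1 = 0 := by
    intro g hg
    have h := congrArg (fun A : Matrix.SpecialLinearGroup (Fin 2) ℂ => A.1 0 1)
      (show g * U ^ 2 = U ^ 2 * g by
        obtain ⟨n, rfl⟩ := hg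
        exact ((Commute.refl U).zpow_left n).pow_right 2)
    simp only [Matrix.SpecialLinearGroup.coe_mul, hU2] at h
    simp [mul_apply, Fin.sum_univ_two] at h
    grind [I_ne_zero]
  have hSmem : S ∈ Subgroup.closure {S, U} := Subgroup.subset_closure (by simp)
  have hUmem : U ∈ Subgroup.closure {S, U} := Subgroup.subset_closure (by simp)
  have hUz := Subgroup.mem_zpowers U
  rw [card_closure_eq_card_mul_card (K := Subgroup.zpowers U) (w := octahedralWord S U),
    Nat.card_zpowers, horder, Nat.card_fin]
  · simpa using hUmem
  · intro i
    fin_cases i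
    exacts [one_mem _, hSmem, mul_mem hSmem hUmem, mul_mem hSmem (pow_mem hUmem 2),
      mul_mem hSmem (pow_mem hUmem 3), mul_mem (mul_mem hSmem hUmem) hSmem]
  · exact ⟨0, rfl⟩
  · have key (g u : Matrix.SpecialLinearGroup (Fin 2) ℂ) (j : Fin 6) (hu : u ∈ Subgroup.zpowers U)
        (h : g = u * octahedralWord S U j) :
        ∃ j, g * (octahedralWord S U j)⁻¹ ∈ Subgroup.zpowers U :=
      ⟨j, by simpa [h] using hu⟩
    have hU4z := pow_mem hUz 4
    have hU3z := mul_mem (pow_mem hUz 2) hUz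
    have hU7z := mul_mem (mul_mem hU4z (pow_mem hUz 2)) hUz
    rintro x (rfl | rfl) i
    · fin_cases i
      · exact key _ 1 1 (one_mem _) rfl
      · exact key _ _ 4 hU7z hSS
      · exact key _ 1 5 (one_mem _) (one_mul _).symm
      · exact key _ _ 2 (mul_mem hU4z hUz) hSUUS
      · exact key _ _ 0 hUz (hSUUUS.trans (mul_one _).symm)
      · exact key _ _ 3 hU3z hSUSS
    · fin_cases i
      · exact key _ _ 0 hUz ((one_mul _).trans (mul_one _).symm)
      · exact key _ 1 2 (one_mem _) (one_mul _).symm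
      · exact key _ 1 3 (one_mem _) (by simp [octahedralWord, pow_two, mul_assoc])
      · exact key _ 1 4 (one_mem _) (by simp [octahedralWord, pow_succ, mul_assoc])
      · exact key _ _ 1 hU4z hSUUUU
      · exact key _ _ 5 hU7z hSUSU
  · intro i j hij
    obtain ⟨s, hs, hi⟩ := octahedralWord_first_row hc2 hS hU i
    obtain ⟨t, ht, hj⟩ := octahedralWord_first_row hc2 hS hU j
    have h := hdiag _ hij
    have h : s * t * (octahedronVertex i 1 * octahedronVertex j 0 -
        octahedronVertex i 0 * octahedronVertex j 1) = 0 := by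
      rw [← h]
      simp [Matrix.SpecialLinearGroup.coe_mul, mul_apply, Fin.sum_univ_two,
        Matrix.SpecialLinearGroup.coe_inv, adjugate_fin_two, hi, hj]
      ring
    exact eq_of_octahedronVertex_proportional (by simpa [hs, ht] using h)
end

section
/- The subgroup of SL(2,ℂ) generated by S, T and V (the binary icosahedral group E_8) has exactly 120 elements. -/
open Complex Matrix

section Explore

variable {α : Type*} [DecidableEq α]

/-- Run `n` steps of a breadth-first search along the maps `fs`; `seen` lists the elements already
visited and `queue` those still to be processed. -/
def explore (fs : List (α → α)) : ℕ → List α → List α → List α × List α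
  | n + 1, seen, v :: queue =>
    if v ∈ seen then explore fs n seen queue
    else explore fs n (v :: seen) (queue ++ fs.map fun f => f v)
  | _, seen, queue => (seen, queue)

/-- The invariant maintained by `explore`, for a predicate `P` on reached elements and
a starting element `a`. -/
structure ExploreInvariant (fs : List (α → α)) (P : α → Prop) (a : α) (s : List α × List α) :
    Prop where
  nodup : s.1.Nodup
  seen : ∀ v ∈ s.1, P v
  queue : ∀ v ∈ s.2, P v
  start : a ∈ s.1 ∨ a ∈ s.2
  closed : ∀ v ∈ s.1, ∀ f ∈ fs, f v ∈ s.1 ∨ f v ∈ s.2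

theorem ExploreInvariant.explore {fs : List (α → α)} {P : α → Prop} {a : α}
    (hP : ∀ f ∈ fs, ∀ v, P v → P (f v)) (n : ℕ) (seen queue : List α)
    (h : ExploreInvariant fs P a (seen, queue)) :
    ExploreInvariant fs P a (explore fs n seen queue) := by
  induction n generalizing seen queue with
  | zero => simpa [_root_.explore] using h
  | succ n ih =>
    obtain ⟨h₁, h₂, h₃, h₄, h₅⟩ := h
    cases queue with
    | nil => exact ⟨h₁, h₂, h₃, h₄, h₅⟩
    | cons v queue =>
      simp only [List.mem_cons, forall_eq_or_imp] at h₃ h₄ h₅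
      rw [_root_.explore]
      split_ifs with hv
      · exact ih _ _ ⟨h₁, h₂, h₃.2, by grind, by grind⟩
      · refine ih _ _ ⟨List.nodup_cons.2 ⟨hv, h₁⟩, ?_, ?_, ?_, ?_⟩
        · simpa using ⟨h₃.1, h₂⟩
        · simp only [List.mem_append, List.mem_map]
          rintro w (hw | ⟨f, hf, rfl⟩)
          exacts [h₃.2 w hw, hP f hf v h₃.1]
        · simp only [List.mem_cons, List.mem_append]
          tauto
        · simp only [List.mem_cons, List.mem_append, List.mem_map]
          rintro w (rfl | hw) f hf
          · exact .inr (.inr ⟨f, hf, rfl⟩)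
          · have := h₅ w hw f hf
            tauto

end Explore

/-- The element `a + b i + (c + d i) φ` of `ℤ[i, φ]`, where `φ` is the golden ratio. -/
@[ext]
structure GoldenGaussian where
  a : ℤ
  b : ℤ
  c : ℤ
  d : ℤ

namespace GoldenGaussian

instance : DecidableEq GoldenGaussian := fun x y =>
  decidable_of_iff (x.a = y.a ∧ x.b = y.b ∧ x.c = y.c ∧ x.d = y.d) GoldenGaussian.ext_iff.symm

def add (x y : GoldenGaussian) : GoldenGaussian :=
  ⟨x.a + y.a, x.b + y.b, x.c + y.c, x.d + y.d⟩

def mul (x y : GoldenGaussian) : GoldenGaussian :=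
  ⟨x.a * y.a - x.b * y.b + (x.c * y.c - x.d * y.d),
    x.a * y.b + x.b * y.a + (x.c * y.d + x.d * y.c),
    x.a * y.c - x.b * y.d + (x.c * y.a - x.d * y.b) + (x.c * y.c - x.d * y.d),
    x.a * y.d + x.b * y.c + (x.c * y.b + x.d * y.a) + (x.c * y.d + x.d * y.c)⟩

/-- The embedding of `ℤ[i, φ]` into `ℂ`. -/
noncomputable def toComplex (x : GoldenGaussian) : ℂ :=
  ⟨x.a + x.c * Real.goldenRatio, x.b + x.d * Real.goldenRatio⟩

theorem toComplex_add (x y : GoldenGaussian) :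
    (x.add y).toComplex = x.toComplex + y.toComplex := by
  apply Complex.ext <;> simp [toComplex, add] <;> ring

theorem toComplex_mul (x y : GoldenGaussian) :
    (x.mul y).toComplex = x.toComplex * y.toComplex := by
  have h := Real.goldenRatio_sq
  apply Complex.ext <;> simp [toComplex, mul]
  · linear_combination (x.d * y.d - x.c * y.c : ℝ) * h
  · linear_combination (-x.c * y.d - x.d * y.c : ℝ) * h

theorem eq_of_add_mul_goldenRatio_eq {a b c d : ℤ}
    (h : (a + b * Real.goldenRatio : ℝ) = c + d * Real.goldenRatio) : a = c ∧ b = d := by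
  have hbd : b = d := by
    by_contra hne
    refine ((Real.goldenRatio_irrational.intCast_mul (sub_ne_zero.2 hne)).ne_int (c - a)) ?_
    push_cast
    linear_combination h
  subst hbd
  exact ⟨by exact_mod_cast add_right_cancel h, rfl⟩

theorem toComplex_injective : Function.Injective toComplex := by
  intro x y h
  obtain ⟨ha, hc⟩ := eq_of_add_mul_goldenRatio_eq (congrArg Complex.re h)
  obtain ⟨hb, hd⟩ := eq_of_add_mul_goldenRatio_eq (congrArg Complex.im h)
  exact GoldenGaussian.ext ha hb hc hd

/-- The action of the matrix `!![α, β; γ, δ]` on column vectors over `ℤ[i, φ]`. -/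
def act (α β γ δ : GoldenGaussian) (v : GoldenGaussian × GoldenGaussian) :
    GoldenGaussian × GoldenGaussian :=
  (add (mul α v.1) (mul β v.2), add (mul γ v.1) (mul δ v.2))

/-- The matrix of `S` in the basis underlying `toColumn`. -/
def actS : GoldenGaussian × GoldenGaussian → GoldenGaussian × GoldenGaussian :=
  act ⟨-1, 1, 1, 0⟩ ⟨0, 1, -1, -1⟩ ⟨1, 1, 0, 0⟩ ⟨0, -1, -1, 0⟩

/-- The matrix of `T` in the basis underlying `toColumn`. -/
def actT : GoldenGaussian × GoldenGaussian → GoldenGaussian × GoldenGaussian :=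
  act ⟨0, 1, 0, 0⟩ ⟨1, 0, -1, -1⟩ ⟨0, 0, 0, 0⟩ ⟨0, -1, 0, 0⟩

/-- The matrix of `V` in the basis underlying `toColumn`. -/
def actV : GoldenGaussian × GoldenGaussian → GoldenGaussian × GoldenGaussian :=
  act ⟨0, -1, 0, 0⟩ ⟨0, 0, 0, 0⟩ ⟨-1, 0, 1, -1⟩ ⟨0, 1, 0, 0⟩

/-- The first basis vector. -/
def origin : GoldenGaussian × GoldenGaussian := (⟨1, 0, 0, 0⟩, ⟨0, 0, 0, 0⟩)

/-- The orbit of `origin` under the three generators, paired with the final (empty) queue. -/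
def orbit : List (GoldenGaussian × GoldenGaussian) × List (GoldenGaussian × GoldenGaussian) :=
  explore [actS, actT, actV] 361 [] [origin]

set_option maxRecDepth 100000 in
theorem orbit_spec : orbit.1.length = 120 ∧ orbit.2 = [] := by
  decide +kernel

/-- The vector with coordinates `v` in the basis `(1, 0)`, `((-φ + i (φ - 1)) / 2, 1 / 2)` of the
`ℤ[i, φ]`-lattice in `ℂ²` spanned by the orbit of `(1, 0)` under the binary icosahedral group. -/
noncomputable def toColumn (v : GoldenGaussian × GoldenGaussian) : Fin 2 → ℂ :=
  ![v.1.toComplex + v.2.toComplex * (toComplex ⟨0, -1, -1, 1⟩ / 2), v.2.toComplex / 2]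

theorem toColumn_injective : Function.Injective toColumn := by
  rintro ⟨p, q⟩ ⟨p', q'⟩ h
  have h₀ := congrFun h 0
  have h₁ := congrFun h 1
  simp only [toColumn, Matrix.cons_val_zero, Matrix.cons_val_one] at h₀ h₁
  obtain rfl : q = q' := toComplex_injective ((div_left_inj' two_ne_zero).1 h₁)
  rw [toComplex_injective (add_right_cancel h₀)]

theorem toColumn_origin : toColumn origin = ![1, 0] := by
  have h₀ : toComplex ⟨0, 0, 0, 0⟩ = 0 := by simp [toComplex, Complex.ext_iff]
  have h₁ : toComplex ⟨1, 0, 0, 0⟩ = 1 := by simp [toComplex, Complex.ext_iff]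
  simp [toColumn, origin, h₀, h₁]

theorem toComplex_eq (x : GoldenGaussian) : x.toComplex =
    x.a + x.b * Complex.I + (x.c + x.d * Complex.I) * ((1 + (Real.sqrt 5 : ℂ)) / 2) := by
  have h : ((1 + (Real.sqrt 5 : ℂ)) / 2) = (Real.goldenRatio : ℂ) := by
    simp [Real.goldenRatio]
  rw [h]
  apply Complex.ext <;> simp [toComplex]

theorem ofReal_sqrt_five_sq : (Real.sqrt 5 : ℂ) ^ 2 = 5 := by
  rw [← Complex.ofReal_pow, Real.sq_sqrt (by norm_num)]
  norm_num

theorem mulVec_toColumn_S (v : GoldenGaussian × GoldenGaussian) :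
    ((1 / 2 : ℂ) • !![-1 + Complex.I, -1 + Complex.I; 1 + Complex.I, -1 - Complex.I]) *ᵥ toColumn v = toColumn (actS v) := by
  have h5 := ofReal_sqrt_five_sq
  have hI := Complex.I_sq
  ext i
  fin_cases i <;>
    simp [toColumn, actS, act, toComplex_add, toComplex_mul, Matrix.mulVec, dotProduct,
      Fin.sum_univ_two]
  all_goals
    generalize v.1.toComplex = p
    generalize v.2.toComplex = q
    simp only [toComplex_eq]
    push_cast
    generalize (Real.sqrt 5 : ℂ) = s at *
    generalize Complex.I = j at *
    grind

theorem mulVec_toColumn_T (v : GoldenGaussian × GoldenGaussian) :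
    !![Complex.I, 0; 0, -Complex.I] *ᵥ toColumn v = toColumn (actT v) := by
  have h5 := ofReal_sqrt_five_sq
  have hI := Complex.I_sq
  ext i
  fin_cases i <;>
    simp [toColumn, actT, act, toComplex_add, toComplex_mul, Matrix.mulVec, dotProduct,
      Fin.sum_univ_two]
  all_goals
    generalize v.1.toComplex = p
    generalize v.2.toComplex = q
    simp only [toComplex_eq]
    push_cast
    generalize (Real.sqrt 5 : ℂ) = s at *
    generalize Complex.I = j at *
    grind

theorem mulVec_toColumn_V (v : GoldenGaussian × GoldenGaussian) :
    !![Complex.I / 2,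
        ((1 - (Real.sqrt 5 : ℂ)) - Complex.I * (1 + (Real.sqrt 5 : ℂ))) / 4;
      (-(1 - (Real.sqrt 5 : ℂ)) - Complex.I * (1 + (Real.sqrt 5 : ℂ))) / 4,
        -Complex.I / 2] *ᵥ toColumn v = toColumn (actV v) := by
  have h5 := ofReal_sqrt_five_sq
  have hI := Complex.I_sq
  ext i
  fin_cases i <;>
    simp [toColumn, actV, act, toComplex_add, toComplex_mul, Matrix.mulVec, dotProduct,
      Fin.sum_univ_two]
  all_goals
    generalize v.1.toComplex = p
    generalize v.2.toComplex = q
    simp only [toComplex_eq]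
    push_cast
    generalize (Real.sqrt 5 : ℂ) = s at *
    generalize Complex.I = j at *
    grind

end GoldenGaussian

namespace Matrix.SpecialLinearGroup

/-- The submonoid of matrices of the form `!![a, -conj b; b, conj a]`. -/
def quaternionic : Submonoid (SpecialLinearGroup (Fin 2) ℂ) where
  carrier := {g | g 0 1 = -star (g 1 0) ∧ g 1 1 = star (g 0 0)}
  one_mem' := by simp
  mul_mem' := by
    rintro g h ⟨hg₁, hg₂⟩ ⟨hh₁, hh₂⟩
    simp only [Set.mem_ofPred_eq, coe_mul, Matrix.mul_apply, Fin.sum_univ_two, hg₁, hg₂, hh₁, hh₂,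
      star_add, star_mul', star_neg, star_star]
    constructor <;> ring

theorem eq_of_mem_quaternionic {g h : SpecialLinearGroup (Fin 2) ℂ} (hg : g ∈ quaternionic)
    (hh : h ∈ quaternionic) (hgh : (g : Matrix (Fin 2) (Fin 2) ℂ) *ᵥ ![1, 0] =
      (h : Matrix (Fin 2) (Fin 2) ℂ) *ᵥ ![1, 0]) : g = h := by
  have h₀ : g 0 0 = h 0 0 := by simpa [Matrix.mulVec, dotProduct] using congrFun hgh 0
  have h₁ : g 1 0 = h 1 0 := by simpa [Matrix.mulVec, dotProduct] using congrFun hgh 1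
  ext i j
  fin_cases i <;> fin_cases j
  exacts [h₀, by simpa [h₁, hh.1] using hg.1, h₁, by simpa [h₀, hh.2] using hg.2]

end Matrix.SpecialLinearGroup

open GoldenGaussian Matrix.SpecialLinearGroup

theorem card_closure_of_mulVec_toColumn (S T V : SpecialLinearGroup (Fin 2) ℂ)
    (hS : ∀ v, (S : Matrix (Fin 2) (Fin 2) ℂ) *ᵥ toColumn v = toColumn (actS v))
    (hT : ∀ v, (T : Matrix (Fin 2) (Fin 2) ℂ) *ᵥ toColumn v = toColumn (actT v))
    (hV : ∀ v, (V : Matrix (Fin 2) (Fin 2) ℂ) *ᵥ toColumn v = toColumn (actV v))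
    (hq : ∀ x ∈ ({S, T, V} : Set (SpecialLinearGroup (Fin 2) ℂ)), x ∈ quaternionic)
    (hfin : ∀ x ∈ ({S, T, V} : Set (SpecialLinearGroup (Fin 2) ℂ)), IsOfFinOrder x) :
    Nat.card (Subgroup.closure ({S, T, V} : Set (SpecialLinearGroup (Fin 2) ℂ))) = 120 := by
  set G := Subgroup.closure ({S, T, V} : Set (SpecialLinearGroup (Fin 2) ℂ))
  have hGM : ∀ g, g ∈ G ↔ g ∈ Submonoid.closure {S, T, V} := fun g => by
    rw [← Subgroup.closure_toSubmonoid_of_isOfFinOrder hfin, Subgroup.mem_toSubmonoid]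
  have hSG : S ∈ G := Subgroup.subset_closure (by simp)
  have hTG : T ∈ G := Subgroup.subset_closure (by simp)
  have hVG : V ∈ G := Subgroup.subset_closure (by simp)
  let column (g : SpecialLinearGroup (Fin 2) ℂ) : Fin 2 → ℂ :=
    (g : Matrix (Fin 2) (Fin 2) ℂ) *ᵥ ![1, 0]
  have hcolumn (x g) : column (x * g) = (x : Matrix (Fin 2) (Fin 2) ℂ) *ᵥ column g := by
    simp only [column, coe_mul, Matrix.mulVec_mulVec]
  have hinj : Set.InjOn column G := fun g hg h hh =>
    eq_of_mem_quaternionic (Submonoid.closure_le.2 hq ((hGM g).1 hg))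
      (Submonoid.closure_le.2 hq ((hGM h).1 hh))
  have hone : toColumn origin = column 1 := by simp [toColumn_origin, column]
  have hinv : ExploreInvariant [actS, actT, actV] (fun v => ∃ g ∈ G, column g = toColumn v)
      origin orbit := by
    refine ExploreInvariant.explore ?_ _ _ _
      ⟨by simp, by simp, by simpa using ⟨1, one_mem G, hone.symm⟩, by simp, by simp⟩
    simp only [List.mem_cons, List.not_mem_nil, or_false]
    rintro f (rfl | rfl | rfl) v ⟨g, hg, hgv⟩
    · exact ⟨S * g, mul_mem hSG hg, by rw [hcolumn, hgv, hS]⟩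
    · exact ⟨T * g, mul_mem hTG hg, by rw [hcolumn, hgv, hT]⟩
    · exact ⟨V * g, mul_mem hVG hg, by rw [hcolumn, hgv, hV]⟩
  obtain ⟨hcard, hqueue⟩ := orbit_spec
  have horigin : origin ∈ orbit.1 := by simpa [hqueue] using hinv.start
  have hclosed : ∀ v ∈ orbit.1, actS v ∈ orbit.1 ∧ actT v ∈ orbit.1 ∧ actV v ∈ orbit.1 := by
    simpa [hqueue] using hinv.closed
  have himage : column '' G = toColumn '' (orbit.1.toFinset : Set _) := by
    apply Set.Subset.antisymm
    · rintro _ ⟨g, hg, rfl⟩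
      replace hg := (hGM g).1 hg
      induction hg using Submonoid.closure_induction_left with
      | one => exact ⟨origin, by simpa using horigin, hone⟩
      | mul_left x hx g hg ih =>
        obtain ⟨v, hv, hvg⟩ := ih
        simp only [List.coe_toFinset, Set.mem_ofPred_eq] at hv
        obtain ⟨h₁, h₂, h₃⟩ := hclosed v hv
        rw [hcolumn, ← hvg]
        obtain rfl | rfl | rfl := hx
        · exact ⟨_, by simpa using h₁, (hS v).symm⟩
        · exact ⟨_, by simpa using h₂, (hT v).symm⟩
        · exact ⟨_, by simpa using h₃, (hV v).symm⟩
    · rintro _ ⟨v, hv, rfl⟩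
      exact hinv.seen v (by simpa using hv)
  calc Nat.card G = (G : Set (SpecialLinearGroup (Fin 2) ℂ)).ncard := rfl
    _ = (column '' G).ncard := hinj.ncard_image.symm
    _ = 120 := by
      rw [himage, Set.ncard_image_of_injective _ toColumn_injective, Set.ncard_coe_finset,
        List.toFinset_card_of_nodup hinv.nodup, hcard]

/-- The binary icosahedral group `E₈ ⊂ SL(2,ℂ)`, generated by
`S = ½[[-1+i, -1+i],[1+i, -1-i]]`, `T = [[i,0],[0,-i]]` and
`V = [[i/2, ((1-√5) - i(1+√5))/4],[(-(1-√5) - i(1+√5))/4, -i/2]]`, has exactly 120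
elements. -/
theorem binary_icosahedral_card (S T V : Matrix.SpecialLinearGroup (Fin 2) ℂ)
    (hS : (S : Matrix (Fin 2) (Fin 2) ℂ) =
      (1 / 2 : ℂ) • !![-1 + Complex.I, -1 + Complex.I; 1 + Complex.I, -1 - Complex.I])
    (hT : (T : Matrix (Fin 2) (Fin 2) ℂ) = !![Complex.I, 0; 0, -Complex.I])
    (hV : (V : Matrix (Fin 2) (Fin 2) ℂ) =
      !![Complex.I / 2,
          ((1 - (Real.sqrt 5 : ℂ)) - Complex.I * (1 + (Real.sqrt 5 : ℂ))) / 4;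
        (-(1 - (Real.sqrt 5 : ℂ)) - Complex.I * (1 + (Real.sqrt 5 : ℂ))) / 4,
          -Complex.I / 2]) :
    Nat.card (Subgroup.closure ({S, T, V} : Set (Matrix.SpecialLinearGroup (Fin 2) ℂ))) = 120 := by
  refine card_closure_of_mulVec_toColumn S T V (fun v => by rw [hS, mulVec_toColumn_S])
    (fun v => by rw [hT, mulVec_toColumn_T]) (fun v => by rw [hV, mulVec_toColumn_V]) ?_ ?_
  · rintro x (rfl | rfl | rfl)
    · constructor <;> simp [hS] <;> ring
    · constructor <;> simp [hT]
    · exact ⟨by simp [hV]; ring, by simp [hV]⟩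
  · have hI := Complex.I_sq
    have h5 := ofReal_sqrt_five_sq
    rintro x (rfl | rfl | rfl) <;> refine isOfFinOrder_iff_pow_eq_one.2 ⟨12, by simp, ?_⟩
    · have h3 : x ^ 3 = 1 := by
        ext i j
        fin_cases i <;> fin_cases j <;>
          simp [pow_succ, hS, Matrix.mul_apply, Fin.sum_univ_two] <;> grind
      rw [show 12 = 3 * 4 from rfl, pow_mul, h3, one_pow]
    · have h4 : x ^ 4 = 1 := by
        ext i j
        fin_cases i <;> fin_cases j <;>
          simp [pow_succ, hT, Matrix.mul_apply, Fin.sum_univ_two]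
      rw [show 12 = 4 * 3 from rfl, pow_mul, h4, one_pow]
    · have h2 : x ^ 2 = -1 := by
        ext i j
        fin_cases i <;> fin_cases j <;>
          simp [pow_two, hV, Matrix.mul_apply, Fin.sum_univ_two] <;> grind
      rw [show 12 = 2 * 6 from rfl, pow_mul, h2, Even.neg_one_pow (by decide)]
end

section
/- Let G be the subgroup of GL(2,ℂ) generated by ω_{10}·I, S and T, where I is the identity matrix (this is the group A_5E_6^{(II)}). Then G is isomorphic as a group to E_6 × ℤ/5ℤ, where E_6 is the subgroup of SL(2,ℂ) generated by S and T. -/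
open Complex Matrix

/-- A subgroup of `SL(n, R)` and a central element `Z` of prime order `p` whose determinant is not `1`
generate a direct product in `GL(n, R)`. -/
theorem nonempty_sup_zpowers_mulEquiv_prod {n R : Type*} [Fintype n] [DecidableEq n] [CommRing R]
    (p : ℕ) [Fact p.Prime] (H : Subgroup (Matrix.SpecialLinearGroup n R)) (Z : GL n R)
    (hcomm : ∀ g : GL n R, Commute g Z) (hp : Z ^ p = 1)
    (hdet : Matrix.GeneralLinearGroup.det Z ≠ 1) :
    Nonempty (↥(H.map Matrix.SpecialLinearGroup.toGL ⊔ Subgroup.zpowers Z) ≃*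
      H × Multiplicative (ZMod p)) := by
  have hZ : Z ≠ 1 := fun h => hdet (by rw [h, map_one])
  have hoZ : orderOf Z = p := orderOf_eq_prime hp hZ
  have hodet : orderOf (Matrix.GeneralLinearGroup.det Z) = p :=
    orderOf_eq_prime (by rw [← map_pow, hp, map_one]) hdet
  let f : H →* GL n R := Matrix.SpecialLinearGroup.toGL.comp H.subtype
  let g : Subgroup.zpowers Z →* GL n R := (Subgroup.zpowers Z).subtype
  have hfg : ∀ x y, Commute (f x) (g y) := by
    rintro x ⟨_, k, rfl⟩
    exact (hcomm _).zpow_right k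
  have hf : Function.Injective f := by
    refine Function.Injective.comp (g := Matrix.SpecialLinearGroup.toGL) ?_ H.subtype_injective
    intro a b hab
    exact Subtype.ext (congrArg Units.val hab)
  have hdisj : Disjoint f.range g.range := by
    rw [Subgroup.disjoint_def]
    rintro _ ⟨a, rfl⟩ ⟨⟨_, k, rfl⟩, hk⟩
    have hk' : Z ^ k = Matrix.SpecialLinearGroup.toGL (a : Matrix.SpecialLinearGroup n R) := hk
    have h1 : Matrix.GeneralLinearGroup.det Z ^ k = 1 := by
      rw [← map_zpow, hk']
      exact Units.ext (a : Matrix.SpecialLinearGroup n R).2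
    rw [← orderOf_dvd_iff_zpow_eq_one, hodet, ← hoZ, orderOf_dvd_iff_zpow_eq_one] at h1
    exact hk.symm.trans h1
  have hinj : Function.Injective (f.noncommCoprod g hfg) :=
    (MonoidHom.noncommCoprod_injective f g hfg).mpr ⟨hf, Subtype.val_injective, hdisj⟩
  have hrange : (f.noncommCoprod g hfg).range =
      H.map Matrix.SpecialLinearGroup.toGL ⊔ Subgroup.zpowers Z := by
    rw [MonoidHom.noncommCoprod_range, MonoidHom.range_comp, Subgroup.range_subtype,
      Subgroup.range_subtype]
  have e : Subgroup.zpowers Z ≃* Multiplicative (ZMod p) :=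
    mulEquivOfPrimeCardEq (p := p) (by rw [Nat.card_zpowers, hoZ]) (by simp)
  exact ⟨(MulEquiv.subgroupCongr hrange.symm).trans
    ((MonoidHom.ofInjective hinj).symm.trans ((MulEquiv.refl H).prodCongr e))⟩

/-- Let `G ⊂ GL(2,ℂ)` be generated by `ω₁₀·I`, `S` and `T` (the group `A₅E₆^{(II)}`,
where `S, T ∈ SL(2,ℂ)` generate the binary tetrahedral group `E₆`).  Then `G` is
isomorphic as a group to `E₆ × ℤ/5ℤ`. -/
theorem A5E6II_iso (S T : Matrix.SpecialLinearGroup (Fin 2) ℂ)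
    (hS : (S : Matrix (Fin 2) (Fin 2) ℂ) =
      (1 / 2 : ℂ) • !![-1 + Complex.I, -1 + Complex.I; 1 + Complex.I, -1 - Complex.I])
    (hT : (T : Matrix (Fin 2) (Fin 2) ℂ) = !![Complex.I, 0; 0, -Complex.I])
    (W : GL (Fin 2) ℂ)
    (hW : (W : Matrix (Fin 2) (Fin 2) ℂ) =
      Complex.exp (2 * Real.pi * Complex.I / 10) • (1 : Matrix (Fin 2) (Fin 2) ℂ)) :
    Nonempty
      ((Subgroup.closure ({W, Matrix.SpecialLinearGroup.toGL S,
          Matrix.SpecialLinearGroup.toGL T} : Set (GL (Fin 2) ℂ))) ≃*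
        (Subgroup.closure ({S, T} : Set (Matrix.SpecialLinearGroup (Fin 2) ℂ))) ×
          Multiplicative (ZMod 5)) := by
  set ω : ℂ := Complex.exp (2 * Real.pi * Complex.I / 10) with hω_def
  have hω : IsPrimitiveRoot ω 10 := by
    simpa [hω_def] using Complex.isPrimitiveRoot_exp 10 (by norm_num)
  have hpow (k : ℕ) : ((W ^ k : GL (Fin 2) ℂ) : Matrix (Fin 2) (Fin 2) ℂ) = ω ^ k • 1 := by
    rw [Units.val_pow_eq_pow_val, hW, smul_pow, one_pow]
  have hω5 : ω ^ 5 = -1 := by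
    have h : IsPrimitiveRoot (ω ^ 5) 2 := hω.pow (by norm_num) (by norm_num)
    exact h.eq_neg_one_of_two_right
  have hTW : Matrix.SpecialLinearGroup.toGL T ^ 2 = W ^ 5 := by
    refine Units.ext ?_
    rw [hpow, hω5, Units.val_pow_eq_pow_val]
    change (T : Matrix (Fin 2) (Fin 2) ℂ) ^ 2 = _
    rw [hT, pow_two]
    ext i j
    fin_cases i <;> fin_cases j <;> simp
  have hW10 : W ^ 10 = 1 := Units.ext (by rw [hpow, hω.pow_eq_one, one_smul, Units.val_one])
  have hcomm (g : GL (Fin 2) ℂ) : Commute g (W ^ 6) := by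
    refine Units.ext ?_
    rw [Units.val_mul, Units.val_mul, hpow]
    simp
  have hdet : Matrix.GeneralLinearGroup.det (W ^ 6) ≠ 1 := by
    intro h
    have h' : Matrix.det ((W ^ 6 : GL (Fin 2) ℂ) : Matrix (Fin 2) (Fin 2) ℂ) = 1 :=
      congrArg Units.val h
    rw [hpow, Matrix.det_smul, Matrix.det_one, mul_one, Fintype.card_fin, ← pow_mul,
      hω.pow_eq_one_iff_dvd] at h'
    norm_num at h'
  have hclosure : Subgroup.closure ({W, Matrix.SpecialLinearGroup.toGL S,
      Matrix.SpecialLinearGroup.toGL T} : Set (GL (Fin 2) ℂ)) =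
      (Subgroup.closure {S, T}).map Matrix.SpecialLinearGroup.toGL ⊔
        Subgroup.zpowers (W ^ 6) := by
    rw [MonoidHom.map_closure, Set.image_pair]
    apply le_antisymm
    · have hTmem : Matrix.SpecialLinearGroup.toGL T ∈ Subgroup.closure
          {Matrix.SpecialLinearGroup.toGL S, Matrix.SpecialLinearGroup.toGL T} :=
        Subgroup.subset_closure (by simp)
      rw [Subgroup.closure_le]
      rintro x (rfl | rfl | rfl)
      · have hx : x = Matrix.SpecialLinearGroup.toGL T ^ 2 * x ^ 6 := by
          rw [hTW, ← pow_add, pow_succ x 10, hW10, one_mul]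
        have hmem := Subgroup.mul_mem_sup (pow_mem hTmem 2) (Subgroup.mem_zpowers (x ^ 6))
        rwa [← hx] at hmem
      · exact Subgroup.mem_sup_left (Subgroup.subset_closure (by simp))
      · exact Subgroup.mem_sup_left hTmem
    · refine sup_le (Subgroup.closure_mono (Set.subset_insert _ _)) ?_
      rw [Subgroup.zpowers_le]
      exact pow_mem (Subgroup.subset_closure (by simp)) 6
  have : Fact (Nat.Prime 5) := ⟨Nat.prime_five⟩
  rw [hclosure]
  exact nonempty_sup_zpowers_mulEquiv_prod 5 _ (W ^ 6) hcomm
    (by rw [← pow_mul, pow_mul W 10 3, hW10, one_pow]) hdet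
end

section
/- Let G be the subgroup of GL(2,ℂ) generated by ω_{10}·I, S and T, where I is the identity matrix (this is the group A_5E_6^{(II)}). Then G has exactly 35 conjugacy classes. -/
open Complex Matrix
open scoped MatrixGroups

/-- Twice the Hurwitz unit lifting an element of `SL(2, 𝔽₃)`, as a Gaussian integer matrix. The
traces of `m` against the quaternion basis give the doubled coordinates modulo `3`; they are
either all nonzero, lifting to `±1`, or vanish but for one, which lifts to `±2`. -/
def doubledHurwitzUnit (m : SL(2, ZMod 3)) : Matrix (Fin 2) (Fin 2) GaussianInt :=
  let a := m 0 0 + m 1 1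
  let b := m 0 1 - m 1 0
  let c := m 1 1 - m 0 0 - m 0 1 - m 1 0
  let d := m 1 1 - m 0 0 + m 0 1 + m 1 0
  let r : ℤ := if a * b * c * d = 0 then -2 else 1
  !![⟨r * a.valMinAbs, r * b.valMinAbs⟩, ⟨r * c.valMinAbs, r * d.valMinAbs⟩;
    ⟨-(r * c.valMinAbs), r * d.valMinAbs⟩, ⟨r * a.valMinAbs, -(r * b.valMinAbs)⟩]

/-- The element of order three of `SL(2, 𝔽₃)` lifting to `S`. -/
def orderThree : SL(2, ZMod 3) := ⟨!![1, 1; 0, 1], by decide⟩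

/-- The element of order four of `SL(2, 𝔽₃)` lifting to `T`. -/
def orderFour : SL(2, ZMod 3) := ⟨!![0, 1; -1, 0], by decide⟩

theorem exists_eq_orderThree_pow_mul (m : SL(2, ZMod 3)) : ∃ a : Fin 3, ∃ b : Fin 4, ∃ c : Fin 2,
    m = orderThree ^ (a : ℕ) * orderFour ^ (b : ℕ) *
      (orderThree * orderFour * orderThree ^ 2) ^ (c : ℕ) := by
  revert m
  decide +kernel

theorem doubledHurwitzUnit_one : doubledHurwitzUnit 1 = (2 : GaussianInt) • 1 := by
  decide +kernel

theorem doubledHurwitzUnit_mul_orderThree (m : SL(2, ZMod 3)) :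
    doubledHurwitzUnit m * doubledHurwitzUnit orderThree =
      (2 : GaussianInt) • doubledHurwitzUnit (m * orderThree) := by
  revert m
  decide +kernel

theorem doubledHurwitzUnit_mul_orderFour (m : SL(2, ZMod 3)) :
    doubledHurwitzUnit m * doubledHurwitzUnit orderFour =
      (2 : GaussianInt) • doubledHurwitzUnit (m * orderFour) := by
  revert m
  decide +kernel

theorem doubledHurwitzUnit_mul (m n : SL(2, ZMod 3)) :
    doubledHurwitzUnit m * doubledHurwitzUnit n =
      (2 : GaussianInt) • doubledHurwitzUnit (m * n) := by
  let P : Submonoid SL(2, ZMod 3) :=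
    { carrier := {n | ∀ m, doubledHurwitzUnit m * doubledHurwitzUnit n =
        (2 : GaussianInt) • doubledHurwitzUnit (m * n)}
      one_mem' := fun m => by rw [doubledHurwitzUnit_one, mul_smul_comm, mul_one, mul_one]
      mul_mem' := fun {n k} hn hk m => by
        apply smul_right_injective _ (two_ne_zero : (2 : GaussianInt) ≠ 0)
        change (2 : GaussianInt) • (_ * _) = (2 : GaussianInt) • _
        rw [← mul_smul_comm, ← hk n, ← mul_assoc, hn m, smul_mul_assoc, hk, mul_assoc] }
  have h3 : orderThree ∈ P := doubledHurwitzUnit_mul_orderThree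
  have h4 : orderFour ∈ P := doubledHurwitzUnit_mul_orderFour
  obtain ⟨a, b, c, rfl⟩ := exists_eq_orderThree_pow_mul n
  exact mul_mem (mul_mem (pow_mem h3 _) (pow_mem h4 _))
    (pow_mem (mul_mem (mul_mem h3 h4) (pow_mem h3 _)) _) m

theorem doubledHurwitzUnit_neg_one : doubledHurwitzUnit (-1) = (-2 : GaussianInt) • 1 := by
  decide +kernel

theorem det_doubledHurwitzUnit (m : SL(2, ZMod 3)) : (doubledHurwitzUnit m).det = 4 := by
  rw [Matrix.det_fin_two]
  revert m
  decide +kernel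

theorem eq_one_of_doubledHurwitzUnit_eq {m : SL(2, ZMod 3)}
    (h : doubledHurwitzUnit m = (2 : GaussianInt) • 1) : m = 1 := by
  revert m
  decide +kernel

theorem card_SL_two_three : Nat.card SL(2, ZMod 3) = 24 := by
  rw [Nat.card_eq_fintype_card]
  decide +kernel

theorem commProb_SL_two_three : commProb SL(2, ZMod 3) = 7 / 24 := by
  have key : Fintype.card {p : SL(2, ZMod 3) × SL(2, ZMod 3) // p.1 * p.2 = p.2 * p.1} = 168 := by
    decide +kernel
  have h : Nat.card {p : SL(2, ZMod 3) × SL(2, ZMod 3) // Commute p.1 p.2} = 168 := by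
    rw [← key, ← Nat.card_eq_fintype_card]
    rfl
  rw [commProb_def, h, card_SL_two_three]
  norm_num

theorem card_conjClasses_SL_two_three_prod_rootsOfUnity :
    Nat.card (ConjClasses (SL(2, ZMod 3) × rootsOfUnity 5 ℂ)) = 35 := by
  have h := commProb_def' (SL(2, ZMod 3) × rootsOfUnity 5 ℂ)
  have hcomm : commProb (rootsOfUnity 5 ℂ) = 1 := commProb_eq_one_iff.2 inferInstance
  rw [commProb_prod, commProb_SL_two_three, hcomm, Nat.card_prod, card_SL_two_three,
    Complex.card_rootsOfUnity] at h
  norm_num at h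
  have : (Nat.card (ConjClasses (SL(2, ZMod 3) × rootsOfUnity 5 ℂ)) : ℚ) = 35 := by linarith
  exact_mod_cast this

theorem MulEquiv.card_conjClasses_eq {G H : Type*} [Group G] [Group H] (e : G ≃* H) :
    Nat.card (ConjClasses G) = Nat.card (ConjClasses H) :=
  Nat.card_congr <| Quotient.congr e.toEquiv fun a b =>
    ⟨fun h => e.toMonoidHom.map_isConj h, fun h => by
      have hinv := e.symm.toMonoidHom.map_isConj (a := e a) (b := e b) h
      rwa [MulEquiv.coe_toMonoidHom, e.symm_apply_apply, e.symm_apply_apply] at hinv⟩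

/-- The lift of `SL(2, 𝔽₃)` to the binary tetrahedral group in `M₂(ℂ)`. -/
noncomputable def hurwitzUnit : SL(2, ZMod 3) →* Matrix (Fin 2) (Fin 2) ℂ where
  toFun m := (1 / 2 : ℂ) • GaussianInt.toComplex.mapMatrix (doubledHurwitzUnit m)
  map_one' := by
    rw [doubledHurwitzUnit_one, RingHom.mapMatrix_apply, Matrix.map_smul' _ _ _ (map_mul _),
      Matrix.map_one _ (map_zero _) (map_one _), smul_smul,
      map_ofNat]
    norm_num
  map_mul' m n := by
    rw [smul_mul_smul_comm, ← map_mul, doubledHurwitzUnit_mul, RingHom.mapMatrix_apply,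
      RingHom.mapMatrix_apply, Matrix.map_smul' _ _ _ (map_mul _), smul_smul,
      map_ofNat]
    norm_num

theorem hurwitzUnit_apply (m : SL(2, ZMod 3)) :
    hurwitzUnit m = (1 / 2 : ℂ) • GaussianInt.toComplex.mapMatrix (doubledHurwitzUnit m) := rfl

theorem hurwitzUnit_neg_one : hurwitzUnit (-1) = -1 := by
  rw [hurwitzUnit_apply, doubledHurwitzUnit_neg_one, RingHom.mapMatrix_apply,
    Matrix.map_smul' _ _ _ (map_mul _), Matrix.map_one _ (map_zero _) (map_one _), smul_smul,
    map_neg, map_ofNat]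
  norm_num

theorem hurwitzUnit_orderThree : hurwitzUnit orderThree =
    (1 / 2 : ℂ) • !![-1 + Complex.I, -1 + Complex.I; 1 + Complex.I, -1 - Complex.I] := by
  have h : doubledHurwitzUnit orderThree = !![⟨-1, 1⟩, ⟨-1, 1⟩; ⟨1, 1⟩, ⟨-1, -1⟩] := by
    decide +kernel
  rw [hurwitzUnit_apply, h]
  congr 1
  ext i j
  fin_cases i <;> fin_cases j <;> simp [GaussianInt.toComplex_def']; ring

theorem hurwitzUnit_orderFour : hurwitzUnit orderFour = !![Complex.I, 0; 0, -Complex.I] := by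
  have h : doubledHurwitzUnit orderFour = !![⟨0, 2⟩, ⟨0, 0⟩; ⟨0, 0⟩, ⟨0, -2⟩] := by
    decide +kernel
  rw [hurwitzUnit_apply, h]
  ext i j
  fin_cases i <;> fin_cases j <;> simp [GaussianInt.toComplex_def']

theorem det_hurwitzUnit (m : SL(2, ZMod 3)) : (hurwitzUnit m).det = 1 := by
  rw [hurwitzUnit_apply, Matrix.det_smul, ← RingHom.map_det, det_doubledHurwitzUnit, map_ofNat]
  norm_num

theorem eq_one_of_hurwitzUnit_eq_one {m : SL(2, ZMod 3)} (h : hurwitzUnit m = 1) : m = 1 := by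
  apply eq_one_of_doubledHurwitzUnit_eq
  apply Matrix.map_injective GaussianInt.toComplex_injective
  change GaussianInt.toComplex.mapMatrix _ = GaussianInt.toComplex.mapMatrix _
  rw [hurwitzUnit_apply] at h
  have h2 := congrArg ((2 : ℂ) • ·) h
  simp only [smul_smul] at h2
  norm_num at h2
  rw [RingHom.mapMatrix_apply, RingHom.mapMatrix_apply, h2, Matrix.map_smul' _ _ _ (map_mul _),
    Matrix.map_one _ (map_zero _) (map_one _), map_ofNat]

/-- The binary tetrahedral group times the scalars of order dividing `5`. -/
noncomputable def scaledHurwitzUnit : SL(2, ZMod 3) × rootsOfUnity 5 ℂ →* GL (Fin 2) ℂ :=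
  MonoidHom.toHomUnits
    { toFun := fun p => ((p.2 : ℂˣ) : ℂ) • hurwitzUnit p.1
      map_one' := by simp
      map_mul' := fun p q => by simp [smul_smul, mul_comm] }

theorem coe_scaledHurwitzUnit (p : SL(2, ZMod 3) × rootsOfUnity 5 ℂ) :
    (scaledHurwitzUnit p : Matrix (Fin 2) (Fin 2) ℂ) = ((p.2 : ℂˣ) : ℂ) • hurwitzUnit p.1 := rfl

theorem scaledHurwitzUnit_injective : Function.Injective scaledHurwitzUnit := by
  refine (injective_iff_map_eq_one _).2 fun ⟨m, z⟩ h => ?_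
  have h : ((z : ℂˣ) : ℂ) • hurwitzUnit m = 1 := congrArg Units.val h
  have hz : (z : ℂˣ) = 1 := by
    have hdet := congrArg Matrix.det h
    rw [Matrix.det_smul, det_hurwitzUnit, Matrix.det_one, Fintype.card_fin, mul_one] at hdet
    have h2 : (z : ℂˣ) ^ 2 = 1 := Units.ext (by simpa using hdet)
    have h5 : (z : ℂˣ) ^ 5 = 1 := (_root_.mem_rootsOfUnity _ _).1 z.2
    calc (z : ℂˣ) = z ^ 5 * ((z : ℂˣ) ^ 2 * (z : ℂˣ) ^ 2)⁻¹ := by group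
      _ = 1 := by rw [h2, h5]; simp
  rw [hz, Units.val_one, one_smul] at h
  exact Prod.ext (eq_one_of_hurwitzUnit_eq_one h) (Subtype.ext hz)

theorem range_scaledHurwitzUnit (S T W : GL (Fin 2) ℂ) {ζ : ℂ} (hζ : IsPrimitiveRoot ζ 10)
    (hS : (S : Matrix (Fin 2) (Fin 2) ℂ) = hurwitzUnit orderThree)
    (hT : (T : Matrix (Fin 2) (Fin 2) ℂ) = hurwitzUnit orderFour)
    (hW : (W : Matrix (Fin 2) (Fin 2) ℂ) = ζ • (1 : Matrix (Fin 2) (Fin 2) ℂ)) :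
    scaledHurwitzUnit.range = Subgroup.closure {W, S, T} := by
  have hmapS : scaledHurwitzUnit (orderThree, 1) = S :=
    Units.ext (by simp [coe_scaledHurwitzUnit, hS])
  have hmapT : scaledHurwitzUnit (orderFour, 1) = T :=
    Units.ext (by simp [coe_scaledHurwitzUnit, hT])
  have hζ5 : ζ ^ 5 = -1 :=
    (hζ.pow (by norm_num) (by norm_num : 10 = 5 * 2)).eq_neg_one_of_two_right
  apply le_antisymm
  · have hSmem : S ∈ Subgroup.closure {W, S, T} := Subgroup.subset_closure (by simp)
    have hTmem : T ∈ Subgroup.closure {W, S, T} := Subgroup.subset_closure (by simp)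
    have hWmem : W ∈ Subgroup.closure {W, S, T} := Subgroup.subset_closure (by simp)
    rintro _ ⟨⟨m, z⟩, rfl⟩
    have hmz : ((m, z) : SL(2, ZMod 3) × rootsOfUnity 5 ℂ) = (m, 1) * (1, z) := by simp
    rw [hmz, map_mul]
    apply mul_mem
    · obtain ⟨a, b, c, rfl⟩ := exists_eq_orderThree_pow_mul m
      have hword : scaledHurwitzUnit (orderThree ^ (a : ℕ) * orderFour ^ (b : ℕ) *
          (orderThree * orderFour * orderThree ^ 2) ^ (c : ℕ), 1) =
          S ^ (a : ℕ) * T ^ (b : ℕ) * (S * T * S ^ 2) ^ (c : ℕ) := by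
        rw [← hmapS, ← hmapT]
        simp only [← map_mul, ← map_pow]
        simp
      rw [hword]
      exact mul_mem (mul_mem (pow_mem hSmem _) (pow_mem hTmem _))
        (pow_mem (mul_mem (mul_mem hSmem hTmem) (pow_mem hSmem _)) _)
    · have hz : ((z : ℂˣ) : ℂ) ^ 5 = 1 := by
        simpa using congrArg Units.val ((_root_.mem_rootsOfUnity _ _).1 z.2)
      obtain ⟨k, -, hk⟩ :=
        (hζ.pow (by norm_num) (by norm_num : 10 = 2 * 5)).eq_pow_of_pow_eq_one hz
      have hWk : scaledHurwitzUnit (1, z) = W ^ (2 * k) := by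
        apply Units.ext
        rw [coe_scaledHurwitzUnit, Units.val_pow_eq_pow_val, hW, smul_pow, one_pow, map_one,
          ← hk, pow_mul]
      rw [hWk]
      exact pow_mem hWmem _
  · rw [Subgroup.closure_le]
    rintro _ (rfl | rfl | rfl)
    · have hz : (-ζ) ^ 5 = 1 := by rw [Odd.neg_pow (by decide), hζ5, neg_neg]
      refine ⟨(-1, rootsOfUnity.mkOfPowEq (-ζ) hz), Units.ext ?_⟩
      simp [coe_scaledHurwitzUnit, hurwitzUnit_neg_one, hW]
    · exact ⟨_, hmapS⟩
    · exact ⟨_, hmapT⟩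

/-- Let `G ⊂ GL(2,ℂ)` be generated by `ω₁₀·I`, `S` and `T` (the group `A₅E₆^{(II)}`).
Then `G` has exactly 35 conjugacy classes. -/
theorem A5E6II_conjClasses (S T W : GL (Fin 2) ℂ)
    (hS : (S : Matrix (Fin 2) (Fin 2) ℂ) =
      (1 / 2 : ℂ) • !![-1 + Complex.I, -1 + Complex.I; 1 + Complex.I, -1 - Complex.I])
    (hT : (T : Matrix (Fin 2) (Fin 2) ℂ) = !![Complex.I, 0; 0, -Complex.I])
    (hW : (W : Matrix (Fin 2) (Fin 2) ℂ) =
      Complex.exp (2 * Real.pi * Complex.I / 10) • (1 : Matrix (Fin 2) (Fin 2) ℂ)) :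
    Nat.card (ConjClasses (Subgroup.closure ({W, S, T} : Set (GL (Fin 2)  ℂ)))) = 35 := by
  have hζ : IsPrimitiveRoot (Complex.exp (2 * Real.pi * Complex.I / 10)) 10 := by
    exact_mod_cast Complex.isPrimitiveRoot_exp 10 (by norm_num)
  rw [← range_scaledHurwitzUnit S T W hζ (hS.trans hurwitzUnit_orderThree.symm)
    (hT.trans hurwitzUnit_orderFour.symm) hW,
    ← (MonoidHom.ofInjective scaledHurwitzUnit_injective).card_conjClasses_eq,
    card_conjClasses_SL_two_three_prod_rootsOfUnity]
end

section
/- Let E_6 be the subgroup of SL(2,ℂ) generated by S and T (the binary tetrahedral group). Then the abelianization E_6/E_6' of E_6 by its commutator (derived) subgroup is isomorphic to the cyclic group ℤ/3ℤ. -/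
open Complex Matrix

/-- The quartic form `x⁴ + w x² y² + y⁴`; for `w² = -12` it is a semi-invariant of the binary
tetrahedral group. -/
def kleinForm (w x y : ℂ) : ℂ := x ^ 4 + w * x ^ 2 * y ^ 2 + y ^ 4

/-- The value of `kleinForm w` at the first column of `g`. -/
def kleinCharacter (w : ℂ) (g : SpecialLinearGroup (Fin 2) ℂ) : ℂ :=
  kleinForm w (g 0 0) (g 1 0)

/-- `g` scales `kleinForm w` by `kleinCharacter w g`. -/
def IsKleinSemiInvariant (w : ℂ) (g : SpecialLinearGroup (Fin 2) ℂ) : Prop :=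
  ∀ x y : ℂ, kleinForm w (g 0 0 * x + g 0 1 * y) (g 1 0 * x + g 1 1 * y) =
    kleinCharacter w g * kleinForm w x y

lemma kleinCharacter_one (w : ℂ) : kleinCharacter w 1 = 1 := by
  simp [kleinCharacter, kleinForm]

lemma IsKleinSemiInvariant.kleinCharacter_mul {w : ℂ} {g : SpecialLinearGroup (Fin 2) ℂ}
    (hg : IsKleinSemiInvariant w g) (h : SpecialLinearGroup (Fin 2) ℂ) :
    kleinCharacter w (g * h) = kleinCharacter w g * kleinCharacter w h := by
  have := hg (h 0 0) (h 1 0)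
  simpa [kleinCharacter, Matrix.mul_apply, Fin.sum_univ_two] using this

lemma IsKleinSemiInvariant.one (w : ℂ) : IsKleinSemiInvariant w 1 := by
  intro x y
  simp [kleinCharacter_one]

lemma IsKleinSemiInvariant.mul {w : ℂ} {g h : SpecialLinearGroup (Fin 2) ℂ}
    (hg : IsKleinSemiInvariant w g) (hh : IsKleinSemiInvariant w h) :
    IsKleinSemiInvariant w (g * h) := by
  intro x y
  rw [hg.kleinCharacter_mul, mul_assoc, ← hh x y, ← hg]
  congr 1 <;> simp [Matrix.mul_apply, Fin.sum_univ_two] <;> ring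

lemma IsKleinSemiInvariant.inv {w : ℂ} {g : SpecialLinearGroup (Fin 2) ℂ}
    (hg : IsKleinSemiInvariant w g) : IsKleinSemiInvariant w g⁻¹ := by
  have hmul : kleinCharacter w g * kleinCharacter w g⁻¹ = 1 := by
    rw [← hg.kleinCharacter_mul, mul_inv_cancel, kleinCharacter_one]
  have hdet : g 0 0 * g 1 1 - g 0 1 * g 1 0 = 1 := by
    rw [← Matrix.det_fin_two, g.det_coe]
  intro x y
  apply mul_left_cancel₀ (left_ne_zero_of_mul_eq_one hmul)
  rw [← hg, ← mul_assoc, hmul, one_mul]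
  congr 1 <;> simp [SpecialLinearGroup.SL2_inv_expl]
  · linear_combination x * hdet
  · linear_combination y * hdet

/-- The character by which a group of semi-invariant matrices acts on `kleinForm w`. -/
def kleinHom (w : ℂ) (H : Subgroup (SpecialLinearGroup (Fin 2) ℂ))
    (hH : ∀ g ∈ H, IsKleinSemiInvariant w g) : H →* ℂ where
  toFun g := kleinCharacter w g
  map_one' := kleinCharacter_one w
  map_mul' g h := (hH g g.2).kleinCharacter_mul h

/-- A group generated by `a` and `b`, with `a ^ 3 = 1` and `b * a * a * b = a * b * a`, has
abelianization of order three as soon as `a` is nontrivial there. -/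
lemma nonempty_abelianization_mulEquiv_zmod_three {G : Type*} [Group G] {a b : G}
    (hgen : Subgroup.closure {a, b} = ⊤) (ha : a ^ 3 = 1) (hab : b * a * a * b = a * b * a)
    (hne : Abelianization.of a ≠ 1) :
    Nonempty (Abelianization G ≃* Multiplicative (ZMod 3)) := by
  have hb : Abelianization.of b = 1 := by
    have h := congrArg Abelianization.of hab
    simp only [map_mul] at h
    rw [mul_comm (Abelianization.of a) (Abelianization.of b)] at h
    exact mul_eq_left.mp h
  have htop : Subgroup.zpowers (Abelianization.of a) = ⊤ := by
    have hmap : (Subgroup.zpowers (Abelianization.of a)).comap Abelianization.of = ⊤ := by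
      rw [eq_top_iff, ← hgen, Subgroup.closure_le]
      rintro g (rfl | rfl)
      · exact Subgroup.mem_zpowers _
      · simp [hb]
    rw [eq_top_iff]
    rintro x -
    obtain ⟨g, rfl⟩ := QuotientGroup.mk_surjective x
    exact Subgroup.mem_comap.mp (hmap ▸ Subgroup.mem_top g)
  have hcard : Nat.card (Abelianization G) = 3 := by
    rw [← Subgroup.card_top, ← htop, Nat.card_zpowers]
    exact orderOf_eq_prime (by rw [← map_pow, ha, map_one]) hne
  exact ⟨mulEquivOfPrimeCardEq (p := 3) hcard (by simp)⟩

/-- Let `E₆ ⊂ SL(2,ℂ)` be the binary tetrahedral group, generated by `S` and `T`.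
Then its abelianization `E₆/E₆'` is isomorphic to the cyclic group `ℤ/3ℤ`. -/
theorem binary_tetrahedral_abelianization (S T : Matrix.SpecialLinearGroup (Fin 2) ℂ)
    (hS : (S : Matrix (Fin 2) (Fin 2) ℂ) =
      (1 / 2 : ℂ) • !![-1 + Complex.I, -1 + Complex.I; 1 + Complex.I, -1 - Complex.I])
    (hT : (T : Matrix (Fin 2) (Fin 2) ℂ) = !![Complex.I, 0; 0, -Complex.I]) :
    Nonempty
      (Abelianization (Subgroup.closure ({S, T} : Set (Matrix.SpecialLinearGroup (Fin 2) ℂ))) ≃*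
        Multiplicative (ZMod 3)) := by
  have hS00 : S 0 0 = (-1 + I) / 2 := by rw [hS]; simp; ring
  have hS01 : S 0 1 = (-1 + I) / 2 := by rw [hS]; simp; ring
  have hS10 : S 1 0 = (1 + I) / 2 := by rw [hS]; simp; ring
  have hS11 : S 1 1 = (-1 - I) / 2 := by rw [hS]; simp; ring
  have hT00 : T 0 0 = I := by simp [hT]
  have hT01 : T 0 1 = 0 := by simp [hT]
  have hT10 : T 1 0 = 0 := by simp [hT]
  have hT11 : T 1 1 = -I := by simp [hT]
  have hI : I ^ 2 = -1 := I_sq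
  have hI3 : I ^ 3 = -I := I_pow_three
  have hI4 : I ^ 4 = 1 := I_pow_four
  obtain ⟨w, hw⟩ := IsAlgClosed.exists_pow_nat_eq (-12 : ℂ) two_pos
  have hχS : kleinCharacter w S = -1 / 2 + w / 4 := by
    simp only [kleinCharacter, kleinForm, hS00, hS10]
    ring_nf
    simp only [hI, hI4]
    ring
  have hχT : kleinCharacter w T = 1 := by
    simp [kleinCharacter, kleinForm, hT00, hT10]
  have hinv : ∀ g ∈ Subgroup.closure {S, T}, IsKleinSemiInvariant w g := by
    intro g hg
    induction hg using Subgroup.closure_induction with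
    | mem g hg =>
      rcases hg with rfl | rfl <;> intro x y
      · simp only [hχS, kleinForm, hS00, hS01, hS10, hS11]
        ring_nf
        simp only [hI, hI3, hI4, hw]
        ring
      · simp only [hχT, kleinForm, hT00, hT01, hT10, hT11]
        ring_nf
        simp only [hI4]
        ring
    | one => exact .one w
    | mul _ _ _ _ hg hh => exact hg.mul hh
    | inv _ _ hg => exact hg.inv
  have hS3 : S ^ 3 = 1 := by
    ext i j
    fin_cases i <;> fin_cases j <;>
      simp [pow_succ, Matrix.mul_apply, Fin.sum_univ_two, hS00, hS01, hS10, hS11] <;>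
      ring_nf <;> simp only [hI, hI3] <;> ring
  have hST : T * S * S * T = S * T * S := by
    ext i j
    fin_cases i <;> fin_cases j <;>
      simp [Matrix.mul_apply, Fin.sum_univ_two, hS00, hS01, hS10, hS11, hT00, hT01, hT10,
        hT11] <;>
      ring_nf <;> simp only [hI, hI3, hI4] <;> ring
  let a : Subgroup.closure {S, T} := ⟨S, Subgroup.subset_closure (by simp)⟩
  let b : Subgroup.closure {S, T} := ⟨T, Subgroup.subset_closure (by simp)⟩
  have hgen : Subgroup.closure {a, b} = ⊤ := by
    rw [← Subgroup.closure_closure_coe_preimage (k := {S, T})]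
    congr 1
    ext g
    simp [a, b, Subtype.ext_iff]
  refine nonempty_abelianization_mulEquiv_zmod_three hgen (Subtype.ext hS3) (Subtype.ext hST) ?_
  intro h
  have hcomm : a ∈ commutator (Subgroup.closure {S, T}) := by
    rwa [← Abelianization.ker_of, MonoidHom.mem_ker]
  have hone : kleinCharacter w S = 1 := by
    have := Abelianization.commutator_subset_ker (kleinHom w _ hinv).toHomUnits hcomm
    exact congrArg Units.val (MonoidHom.mem_ker.mp this)
  have hw6 : w = 6 := by linear_combination 4 * hone - 4 * hχS
  norm_num [hw6] at hw
end

section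
/- Let E_7 be the subgroup of SL(2,ℂ) generated by S and U (the binary octahedral group). Then the abelianization E_7/E_7' of E_7 by its commutator (derived) subgroup is isomorphic to the cyclic group ℤ/2ℤ. -/
open Complex Matrix
open scoped commutatorElement

/-- The subring `ℚ(i)` of `ℂ`. -/
def gaussianRationals : Subring ℂ where
  carrier := {z | ∃ p q : ℚ, z = p + q * I}
  mul_mem' := by
    rintro _ _ ⟨p, q, rfl⟩ ⟨r, s, rfl⟩
    refine ⟨p * r - q * s, p * s + q * r, ?_⟩
    push_cast
    linear_combination (q * s : ℂ) * I_mul_I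
  one_mem' := ⟨1, 0, by simp⟩
  add_mem' := by
    rintro _ _ ⟨p, q, rfl⟩ ⟨r, s, rfl⟩
    exact ⟨p + r, q + s, by push_cast; ring⟩
  zero_mem' := ⟨0, 0, by simp⟩
  neg_mem' := by
    rintro _ ⟨p, q, rfl⟩
    exact ⟨-p, -q, by push_cast; ring⟩

theorem I_mem_gaussianRationals : I ∈ gaussianRationals := ⟨0, 1, by simp⟩

theorem sq_ofReal_sqrt_two : ((Real.sqrt 2 : ℝ) : ℂ) ^ 2 = 2 := by
  rw [← ofReal_pow, Real.sq_sqrt (by norm_num)]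
  simp

theorem ofReal_sqrt_two_ne_zero : ((Real.sqrt 2 : ℝ) : ℂ) ≠ 0 := by
  simp

theorem inv_sqrt_two_mul_one_add_I_notMem :
    ((Real.sqrt 2 : ℝ) : ℂ)⁻¹ * (1 + I) ∉ gaussianRationals := by
  rintro ⟨p, q, h⟩
  have h' := congrArg re h
  rw [← ofReal_inv, re_ofReal_mul] at h'
  simp at h'
  refine irrational_sqrt_two ⟨p⁻¹, ?_⟩
  rw [Rat.cast_inv, ← h', inv_inv]

namespace Matrix.SpecialLinearGroup

/-- Over a subring `R` of `K`, the elements of `SL(n, K)` that are a scalar `a` with `a ^ 2 ∈ R`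
times a matrix with entries in `R`. -/
def scaledSubgroup {n K : Type*} [Fintype n] [DecidableEq n] [CommRing K] (R : Subring K)
    (hn : Fintype.card n = 2) : Subgroup (SpecialLinearGroup n K) where
  carrier := {g | ∃ (a : K) (A : Matrix n n R), a ^ 2 ∈ R ∧
    (g : Matrix n n K) = a • R.subtype.mapMatrix A}
  mul_mem' := by
    rintro g h ⟨a, A, ha, hA⟩ ⟨b, B, hb, hB⟩
    refine ⟨a * b, A * B, by rw [mul_pow]; exact mul_mem ha hb, ?_⟩
    rw [coe_mul, hA, hB, map_mul, smul_mul_smul_comm]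
  one_mem' := ⟨1, 1, by simp, by simp⟩
  inv_mem' := by
    rintro g ⟨a, A, ha, hA⟩
    refine ⟨a, A.adjugate, ha, ?_⟩
    rw [coe_inv, hA, adjugate_smul, hn, RingHom.map_adjugate, pow_one]

theorem commutatorElement_mem_range_map {n K : Type*} [Fintype n] [DecidableEq n] [CommRing K]
    (R : Subring K) (hn : Fintype.card n = 2) {g h : SpecialLinearGroup n K}
    (hg : g ∈ scaledSubgroup R hn) (hh : h ∈ scaledSubgroup R hn) :
    ⁅g, h⁆ ∈ (map (n := n) R.subtype).range := by
  obtain ⟨a, A, ha, hA⟩ := hg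
  obtain ⟨b, B, hb, hB⟩ := hh
  set M : Matrix n n R :=
    ((⟨a ^ 2, ha⟩ : R) * ⟨b ^ 2, hb⟩) • (A * B * A.adjugate * B.adjugate) with hM
  have key : R.subtype.mapMatrix M = (⁅g, h⁆ : SpecialLinearGroup n K) := by
    have hsm : ∀ (r : R) (N : Matrix n n R),
        R.subtype.mapMatrix (r • N) = (r : K) • R.subtype.mapMatrix N := by
      intro r N
      ext i j
      simp
    rw [commutatorElement_def, coe_mul, coe_mul, coe_mul, coe_inv, coe_inv, hA, hB, hM, hsm]
    simp only [adjugate_smul, hn, map_mul, RingHom.map_adjugate, Nat.add_one_sub_one, pow_one,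
      smul_mul_smul_comm, Subring.coe_mul]
    congr 1
    ring
  have hdet : M.det = 1 := by
    apply R.subtype_injective
    rw [RingHom.map_det, key, map_one, det_coe]
  exact ⟨⟨M, hdet⟩, Subtype.ext key⟩

end Matrix.SpecialLinearGroup

theorem Abelianization.of_closure_pair_eq_one_or {G : Type*} [Group G] {s u : G}
    (hs_mem : s ∈ Subgroup.closure {s, u}) (hu_mem : u ∈ Subgroup.closure {s, u})
    (hs : s ^ 3 = 1) (hu : u ^ 8 = 1) (hsu : (s * u⁻¹) ^ 2 = u ^ 4)
    (x : Abelianization (Subgroup.closure {s, u})) :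
    x = 1 ∨ x = Abelianization.of ⟨u, hu_mem⟩ := by
  set σ := Abelianization.of (⟨s, hs_mem⟩ : Subgroup.closure {s, u}) with hσ
  set υ := Abelianization.of (⟨u, hu_mem⟩ : Subgroup.closure {s, u}) with hυ
  have h1 : σ ^ 3 = 1 := by
    rw [hσ, ← map_pow, ← map_one Abelianization.of]; congr 1; exact Subtype.ext hs
  have h2 : υ ^ 8 = 1 := by
    rw [hυ, ← map_pow, ← map_one Abelianization.of]; congr 1; exact Subtype.ext hu
  have h3 : σ ^ 2 = υ ^ 6 := by
    have : (σ * υ⁻¹) ^ 2 = υ ^ 4 := by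
      rw [hσ, hυ, ← map_inv, ← map_mul, ← map_pow, ← map_pow]; congr 1; exact Subtype.ext hsu
    rw [mul_pow, inv_pow, mul_inv_eq_iff_eq_mul, ← pow_add] at this
    exact this
  have h4 : υ ^ 2 = 1 := by
    calc υ ^ 2 = (υ ^ 6) ^ 3 * (υ ^ 8)⁻¹ ^ 2 := by group
      _ = (σ ^ 3) ^ 2 := by rw [← h3, h2]; group
      _ = 1 := by rw [h1, one_pow]
  have h5 : σ = 1 := by
    calc σ = σ ^ 3 * (σ ^ 2)⁻¹ := by group
      _ = ((υ ^ 2) ^ 3)⁻¹ := by rw [h1, h3]; group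
      _ = 1 := by rw [h4]; simp
  obtain ⟨⟨g, hg⟩, rfl⟩ := QuotientGroup.mk_surjective x
  change Abelianization.of _ = 1 ∨ Abelianization.of _ = υ
  induction hg using Subgroup.closure_induction with
  | mem y hy =>
    rcases hy with rfl | rfl
    · exact Or.inl h5
    · exact Or.inr rfl
  | one => exact Or.inl (map_one _)
  | mul a b ha hb iha ihb =>
    have : Abelianization.of (⟨a * b, mul_mem ha hb⟩ : Subgroup.closure {s, u}) =
      Abelianization.of ⟨a, ha⟩ * Abelianization.of ⟨b, hb⟩ :=
        map_mul Abelianization.of (⟨a, ha⟩ : Subgroup.closure {s, u}) ⟨b, hb⟩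
    rw [this]
    rcases iha with h | h <;> rcases ihb with h' | h' <;> simp [h, h', ← pow_two, h4]
  | inv a ha iha =>
    have : Abelianization.of (⟨a⁻¹, inv_mem ha⟩ : Subgroup.closure {s, u}) =
      (Abelianization.of ⟨a, ha⟩)⁻¹ :=
        map_inv Abelianization.of (⟨a, ha⟩ : Subgroup.closure {s, u})
    rw [this]
    rcases iha with h | h
    · simp [h]
    · right
      rw [h, inv_eq_iff_mul_eq_one, ← pow_two, h4]

/-- Let `E₇ ⊂ SL(2,ℂ)` be the binary octahedral group, generated by `S` and `U`.
Then its abelianization `E₇/E₇'` is isomorphic to the cyclic group `ℤ/2ℤ`. -/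
theorem binary_octahedral_abelianization (S U : Matrix.SpecialLinearGroup (Fin 2) ℂ)
    (hS : (S : Matrix (Fin 2) (Fin 2) ℂ) =
      (1 / 2 : ℂ) • !![-1 + Complex.I, -1 + Complex.I; 1 + Complex.I, -1 - Complex.I])
    (hU : (U : Matrix (Fin 2) (Fin 2) ℂ) =
      ((Real.sqrt 2 : ℂ))⁻¹ • !![1 + Complex.I, 0; 0, 1 - Complex.I]) :
    Nonempty
      (Abelianization (Subgroup.closure ({S, U} : Set (Matrix.SpecialLinearGroup (Fin 2) ℂ))) ≃*
        Multiplicative (ZMod 2)) := by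
  have hSmem : S ∈ Subgroup.closure {S, U} := Subgroup.subset_closure (by simp)
  have hUmem : U ∈ Subgroup.closure {S, U} := Subgroup.subset_closure (by simp)
  have hI := I_sq
  have hr : (((Real.sqrt 2 : ℝ) : ℂ)⁻¹) ^ 2 = 1 / 2 := by
    rw [inv_pow, sq_ofReal_sqrt_two]; norm_num
  have hS3 : S ^ 3 = 1 := by
    apply Subtype.ext
    rw [Matrix.SpecialLinearGroup.coe_pow, hS, Matrix.SpecialLinearGroup.coe_one]
    ext i j
    fin_cases i <;> fin_cases j <;> simp [pow_succ, Matrix.mul_apply, Fin.sum_univ_two] <;> grind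
  have hU2 : (U : Matrix (Fin 2) (Fin 2) ℂ) ^ 2 = !![I, 0; 0, -I] := by
    rw [hU, smul_pow, hr]
    ext i j
    fin_cases i <;> fin_cases j <;> simp [pow_two] <;> grind
  have hU4 : (U : Matrix (Fin 2) (Fin 2) ℂ) ^ 4 = -1 := by
    rw [show 4 = 2 * 2 from rfl, pow_mul, hU2]
    ext i j
    fin_cases i <;> fin_cases j <;> simp [pow_two]
  have hU8 : U ^ 8 = 1 := by
    apply Subtype.ext
    rw [Matrix.SpecialLinearGroup.coe_pow, show 8 = 4 * 2 from rfl, pow_mul, hU4]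
    simp
  have hSU : (S * U⁻¹) ^ 2 = U ^ 4 := by
    apply Subtype.ext
    rw [Matrix.SpecialLinearGroup.coe_pow, Matrix.SpecialLinearGroup.coe_pow, hU4, Matrix.SpecialLinearGroup.coe_mul,
      Matrix.SpecialLinearGroup.coe_inv, hU, hS, adjugate_smul, smul_mul_smul_comm, smul_pow,
      mul_pow, Fintype.card_fin, pow_one, hr, adjugate_fin_two_of]
    ext i j
    fin_cases i <;> fin_cases j <;> simp [pow_two] <;> grind
  have hle : Subgroup.closure {S, U} ≤
      SpecialLinearGroup.scaledSubgroup gaussianRationals (Fintype.card_fin 2) := by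
    have hhalf : (1 / 2 : ℂ) ∈ gaussianRationals := ⟨1 / 2, 0, by simp⟩
    set i : gaussianRationals := ⟨I, I_mem_gaussianRationals⟩ with hi
    rw [Subgroup.closure_le]
    rintro _ (rfl | rfl)
    · refine ⟨1 / 2, !![-1 + i, -1 + i; 1 + i, -1 - i], pow_mem hhalf 2, ?_⟩
      rw [hS]
      ext j k
      fin_cases j <;> fin_cases k <;> simp [hi]
    · refine ⟨((Real.sqrt 2 : ℝ) : ℂ)⁻¹, !![1 + i, 0; 0, 1 - i], hr ▸ hhalf, ?_⟩
      rw [hU]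
      ext j k
      fin_cases j <;> fin_cases k <;> simp [hi]
  have hne : Abelianization.of (⟨U, hUmem⟩ : Subgroup.closure {S, U}) ≠ 1 := by
    intro h
    have hmem : (⟨U, hUmem⟩ : Subgroup.closure {S, U}) ∈ commutator _ :=
      (QuotientGroup.eq_one_iff _).1 h
    have hcomm : commutator (Subgroup.closure {S, U}) ≤
        (SpecialLinearGroup.map (n := Fin 2) gaussianRationals.subtype).range.comap
          (Subgroup.closure {S, U}).subtype := by
      rw [commutator_def, Subgroup.commutator_le]
      intro g _ h _
      rw [Subgroup.mem_comap, map_commutatorElement]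
      exact SpecialLinearGroup.commutatorElement_mem_range_map _ (Fintype.card_fin 2)
        (hle g.2) (hle h.2)
    obtain ⟨V, hV⟩ := hcomm hmem
    have hV' := congrArg (fun g : SpecialLinearGroup (Fin 2) ℂ => g.1 0 0) hV
    apply inv_sqrt_two_mul_one_add_I_notMem
    have : U.1 0 0 = ((Real.sqrt 2 : ℝ) : ℂ)⁻¹ * (1 + I) := by rw [hU]; simp
    rw [← this]
    exact hV' ▸ (V.1 0 0).2
  have hcard : Nat.card (Abelianization (Subgroup.closure {S, U})) = 2 := by
    rw [Nat.card_eq_two_iff]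
    refine ⟨1, _, hne.symm, Set.eq_univ_of_forall fun x => ?_⟩
    simpa using Abelianization.of_closure_pair_eq_one_or hSmem hUmem hS3 hU8 hSU x
  exact ⟨mulEquivOfPrimeCardEq (p := 2) hcard (by simp)⟩
end

section
/- Let E_8 be the subgroup of SL(2,ℂ) generated by S, T and V (the binary icosahedral group). Then E_8 is perfect: its commutator (derived) subgroup E_8' equals all of E_8, so the abelianization E_8/E_8' is trivial. -/
open Complex Matrix

/-- A group generated by three elements subject to `s v = v s²`, `s t s = t s² t` and
`v t v t = t v` is perfect. -/
theorem commutator_eq_top_of_relations {G : Type*} [Group G] {s t v : G}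
    (hgen : Subgroup.closure {s, t, v} = ⊤) (hsv : s * v = v * s * s)
    (hst : s * t * s = t * s * s * t) (htv : v * t * v * t = t * v) :
    commutator G = ⊤ := by
  have hs : Abelianization.of s = 1 := by
    have h := congrArg Abelianization.of hsv
    simp only [map_mul] at h
    rw [mul_comm (Abelianization.of s), mul_assoc, mul_right_inj] at h
    simpa using h
  have ht : Abelianization.of t = 1 := by
    have h := congrArg Abelianization.of hst
    simpa [hs] using h
  have hv : Abelianization.of v = 1 := by
    have h := congrArg Abelianization.of htv
    simpa [ht] using h
  rw [eq_top_iff, ← hgen, Subgroup.closure_le, ← Abelianization.ker_of]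
  rintro x (rfl | rfl | rfl)
  exacts [hs, ht, hv]

/-- Let `E₈ ⊂ SL(2,ℂ)` be the binary icosahedral group, generated by `S`, `T` and `V`.
Then `E₈` is perfect: its commutator subgroup `E₈'` is all of `E₈` (so the
abelianization `E₈/E₈'` is trivial). -/
theorem binary_icosahedral_perfect (S T V : Matrix.SpecialLinearGroup (Fin 2) ℂ)
    (hS : (S : Matrix (Fin 2) (Fin 2) ℂ) =
      (1 / 2 : ℂ) • !![-1 + Complex.I, -1 + Complex.I; 1 + Complex.I, -1 - Complex.I])
    (hT : (T : Matrix (Fin 2) (Fin 2) ℂ) = !![Complex.I, 0; 0, -Complex.I])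
    (hV : (V : Matrix (Fin 2) (Fin 2) ℂ) =
      !![Complex.I / 2,
          ((1 - (Real.sqrt 5 : ℂ)) - Complex.I * (1 + (Real.sqrt 5 : ℂ))) / 4;
        (-(1 - (Real.sqrt 5 : ℂ)) - Complex.I * (1 + (Real.sqrt 5 : ℂ))) / 4,
          -Complex.I / 2]) :
    commutator
      (Subgroup.closure ({S, T, V} : Set (Matrix.SpecialLinearGroup (Fin 2) ℂ))) = ⊤ := by
  have hI : Complex.I ^ 2 = -1 := Complex.I_sq
  have h5 : (Real.sqrt 5 : ℂ) ^ 2 = 5 := by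
    rw [← Complex.ofReal_pow, Real.sq_sqrt (by norm_num)]
    norm_num
  generalize (Real.sqrt 5 : ℂ) = r at hV h5
  generalize Complex.I = i at hS hT hV hI
  have hsv : S * V = V * S * S := by
    apply Subtype.ext
    simp only [Matrix.SpecialLinearGroup.coe_mul, hS, hV]
    ext a b
    fin_cases a <;> fin_cases b <;> simp [Matrix.mul_apply, Fin.sum_univ_two] <;> grind
  have hst : S * T * S = T * S * S * T := by
    apply Subtype.ext
    simp only [Matrix.SpecialLinearGroup.coe_mul, hS, hT]
    ext a b
    fin_cases a <;> fin_cases b <;> simp [Matrix.mul_apply, Fin.sum_univ_two] <;> grind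
  have htv : V * T * V * T = T * V := by
    apply Subtype.ext
    simp only [Matrix.SpecialLinearGroup.coe_mul, hT, hV]
    ext a b
    fin_cases a <;> fin_cases b <;> simp [Matrix.mul_apply, Fin.sum_univ_two] <;> grind
  have hmem : ∀ x ∈ ({S, T, V} : Set _), x ∈ Subgroup.closure {S, T, V} :=
    fun x hx => Subgroup.subset_closure hx
  refine commutator_eq_top_of_relations (s := ⟨S, hmem S (by simp)⟩) (t := ⟨T, hmem T (by simp)⟩)
    (v := ⟨V, hmem V (by simp)⟩) ?_ (Subtype.ext hsv) (Subtype.ext hst) (Subtype.ext htv)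
  rw [← Subgroup.closure_closure_coe_preimage (k := {S, T, V})]
  congr 1
  ext x
  simp [Subtype.ext_iff]
end

section
/- For finite groups G₁ and G₂, the Schur multiplier of the direct product satisfies M(G₁ × G₂) ≅ M(G₁) × M(G₂) × Hom(G₁/G₁', G₂/G₂'), an isomorphism of abelian groups, where Hom denotes the group of homomorphisms between the abelianizations. -/
open groupCohomology

namespace TrivialCocycle

variable {G H A : Type} [Group G] [Group H] [AddCommGroup A]

theorem mem_cocycles₂_iff (f : G × G → A) :
    f ∈ cocycles₂ (Rep.trivial ℤ G A) ↔
      ∀ g h j : G, f (g * h, j) + f (g, h) = f (h, j) + f (g, h * j) :=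
  groupCohomology.mem_cocycles₂_iff (A := Rep.trivial ℤ G A) f

theorem map_mul_add (f : cocycles₂ (Rep.trivial ℤ G A)) (g h j : G) :
    f.1 (g * h, j) + f.1 (g, h) = f.1 (h, j) + f.1 (g, h * j) :=
  (mem_cocycles₂_iff f.1).1 f.2 g h j

theorem map_one_left (f : cocycles₂ (Rep.trivial ℤ G A)) (g : G) : f.1 (1, g) = f.1 (1, 1) :=
  cocycles₂_map_one_fst f g

theorem map_one_right (f : cocycles₂ (Rep.trivial ℤ G A)) (g : G) : f.1 (g, 1) = f.1 (1, 1) :=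
  cocycles₂_map_one_snd f g

theorem mem_coboundaries₂_iff (f : G × G → A) :
    f ∈ coboundaries₂ (Rep.trivial ℤ G A) ↔
      ∃ c : G → A, ∀ g h : G, c h - c (g * h) + c g = f (g, h) := by
  refine LinearMap.mem_range.trans (exists_congr fun c => ?_)
  rw [funext_iff, Prod.forall]
  rfl

theorem const_mem_coboundaries₂ (a : A) :
    (fun _ => a) ∈ coboundaries₂ (Rep.trivial ℤ G A) :=
  (mem_coboundaries₂_iff _).2 ⟨fun _ => a, fun _ _ => by abel⟩

/-- The quotient map from 2-cocycles to second cohomology, as an additive homomorphism. -/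
noncomputable def toH2 (G A : Type) [Group G] [AddCommGroup A] :
    cocycles₂ (Rep.trivial ℤ G A) →+ groupCohomology (Rep.trivial ℤ G A) 2 :=
  (H2π (Rep.trivial ℤ G A)).hom.toAddMonoidHom

theorem toH2_surjective : Function.Surjective (toH2 G A) :=
  (ModuleCat.epi_iff_surjective (H2π (Rep.trivial ℤ G A))).1 inferInstance

theorem toH2_eq_zero_iff (f : cocycles₂ (Rep.trivial ℤ G A)) :
    toH2 G A f = 0 ↔ f.1 ∈ coboundaries₂ (Rep.trivial ℤ G A) :=
  H2π_eq_zero_iff f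

theorem toH2_eq_iff (f f' : cocycles₂ (Rep.trivial ℤ G A)) :
    toH2 G A f = toH2 G A f' ↔ f.1 - f'.1 ∈ coboundaries₂ (Rep.trivial ℤ G A) :=
  H2π_eq_iff f f'

/-- Pullback of 2-cocycles along a group homomorphism. -/
def comap (φ : H →* G) :
    cocycles₂ (Rep.trivial ℤ G A) →+ cocycles₂ (Rep.trivial ℤ H A) where
  toFun f := ⟨fun x => f.1 (φ x.1, φ x.2), (mem_cocycles₂_iff _).2 fun g h j => by
    simpa only [map_mul] using map_mul_add f (φ g) (φ h) (φ j)⟩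
  map_zero' := rfl
  map_add' _ _ := rfl

theorem comap_apply (φ : H →* G) (f : cocycles₂ (Rep.trivial ℤ G A)) (x y : H) :
    (comap φ f).1 (x, y) = f.1 (φ x, φ y) := rfl

theorem comap_mem_coboundaries₂ (φ : H →* G) {f : cocycles₂ (Rep.trivial ℤ G A)}
    (hf : f.1 ∈ coboundaries₂ (Rep.trivial ℤ G A)) :
    (comap φ f).1 ∈ coboundaries₂ (Rep.trivial ℤ H A) := by
  obtain ⟨c, hc⟩ := (mem_coboundaries₂_iff _).1 hf
  refine (mem_coboundaries₂_iff _).2 ⟨c ∘ φ, fun g h => ?_⟩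
  rw [comap_apply, ← hc, ← map_mul]
  rfl

theorem sub_swap_mul_left (f : cocycles₂ (Rep.trivial ℤ G A)) {x y z : G}
    (hx : Commute x z) (hy : Commute y z) :
    f.1 (x * y, z) - f.1 (z, x * y) =
      (f.1 (x, z) - f.1 (z, x)) + (f.1 (y, z) - f.1 (z, y)) := by
  have h₁ := map_mul_add f x y z
  have h₂ := map_mul_add f z x y
  have h₃ := map_mul_add f x z y
  rw [hy.eq] at h₁
  rw [← hx.eq] at h₂
  linear_combination (norm := module) h₁ + h₂ - h₃

theorem sub_swap_mul_right (f : cocycles₂ (Rep.trivial ℤ G A)) {x y z : G}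
    (hx : Commute x z) (hy : Commute y z) :
    f.1 (z, x * y) - f.1 (x * y, z) =
      (f.1 (z, x) - f.1 (x, z)) + (f.1 (z, y) - f.1 (y, z)) := by
  rw [← neg_sub, sub_swap_mul_left f hx hy]
  abel

variable {G₁ G₂ M : Type} [Group G₁] [Group G₂] [CommGroup M]

/-- The pairing `(g, h) ↦ f (g, h) - f (h, g)` of the two factors of a direct product
induced by a 2-cocycle `f`. -/
def pairing :
    cocycles₂ (Rep.trivial ℤ (G₁ × G₂) (Additive M)) →+ Additive (G₁ →* G₂ →* M) where
  toFun f := .ofMul <| MonoidHom.mk' (fun g => MonoidHom.mk' (fun h => Additive.toMul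
      (f.1 (MonoidHom.inl G₁ G₂ g, MonoidHom.inr G₁ G₂ h) -
        f.1 (MonoidHom.inr G₁ G₂ h, MonoidHom.inl G₁ G₂ g)))
      fun h h' => by
        rw [map_mul, sub_swap_mul_right f (MonoidHom.commute_inl_inr g h).symm
          (MonoidHom.commute_inl_inr g h').symm]
        rfl)
    fun g g' => by
      ext h
      change Additive.toMul _ = _
      rw [map_mul, sub_swap_mul_left f (MonoidHom.commute_inl_inr g h)
        (MonoidHom.commute_inl_inr g' h)]
      rfl
  map_zero' := by
    ext
    exact congrArg Additive.toMul (sub_self (0 : Additive M))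
  map_add' f f' := by
    ext g h
    exact congrArg Additive.toMul (add_sub_add_comm
      (f.1 (MonoidHom.inl G₁ G₂ g, MonoidHom.inr G₁ G₂ h)) _ _ _)

theorem pairing_apply (f : cocycles₂ (Rep.trivial ℤ (G₁ × G₂) (Additive M))) (g : G₁) (h : G₂) :
    Additive.ofMul ((pairing f).toMul g h) =
      f.1 ((g, 1), (1, h)) - f.1 ((1, h), (g, 1)) := rfl

theorem pairing_eq_zero_of_mem_coboundaries₂
    {f : cocycles₂ (Rep.trivial ℤ (G₁ × G₂) (Additive M))}
    (hf : f.1 ∈ coboundaries₂ (Rep.trivial ℤ (G₁ × G₂) (Additive M))) : pairing f = 0 := by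
  obtain ⟨c, hc⟩ := (mem_coboundaries₂_iff _).1 hf
  apply Additive.toMul.injective
  ext g h
  apply Additive.ofMul.injective
  rw [pairing_apply, ← hc, ← hc, Prod.mk_mul_mk, Prod.mk_mul_mk]
  simp only [one_mul, mul_one, toMul_zero, MonoidHom.one_apply, ofMul_one]
  abel

theorem mem_coboundaries₂_of_restrict {f : cocycles₂ (Rep.trivial ℤ (G₁ × G₂) (Additive M))}
    (h₁ : (comap (MonoidHom.inl G₁ G₂) f).1 ∈ coboundaries₂ (Rep.trivial ℤ G₁ (Additive M)))
    (h₂ : (comap (MonoidHom.inr G₁ G₂) f).1 ∈ coboundaries₂ (Rep.trivial ℤ G₂ (Additive M)))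
    (h : pairing f = 0) : f.1 ∈ coboundaries₂ (Rep.trivial ℤ (G₁ × G₂) (Additive M)) := by
  obtain ⟨a, ha⟩ := (mem_coboundaries₂_iff _).1 h₁
  obtain ⟨b, hb⟩ := (mem_coboundaries₂_iff _).1 h₂
  refine (mem_coboundaries₂_iff _).2
    ⟨fun x => a x.1 + b x.2 - f.1 ((x.1, 1), (1, x.2)), ?_⟩
  rintro ⟨g, k⟩ ⟨g', k'⟩
  have e₁ := ha g g'
  have e₂ := hb k k'
  have e₃ : f.1 ((g', 1), (1, k)) - f.1 ((1, k), (g', 1)) = 0 := by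
    rw [← pairing_apply, h]
    rfl
  have c₁ := map_mul_add f (g, 1) (1, k) (g', k')
  have c₂ := map_mul_add f (1, k) (g', 1) (1, k')
  have c₃ := map_mul_add f (g', 1) (1, k) (1, k')
  have c₄ := map_mul_add f (g, 1) (g', 1) (1, k * k')
  simp only [comap_apply, MonoidHom.inl_apply, MonoidHom.inr_apply] at e₁ e₂
  simp only [Prod.mk_mul_mk, one_mul, mul_one] at c₁ c₂ c₃ c₄ ⊢
  linear_combination (norm := module) e₁ + e₂ - c₁ + c₂ - c₃ + c₄ + e₃

/-- The 2-cocycle on a direct product assembled from 2-cocycles on the factors and a pairing. -/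
def ofFactors (f₁ : cocycles₂ (Rep.trivial ℤ G₁ (Additive M)))
    (f₂ : cocycles₂ (Rep.trivial ℤ G₂ (Additive M))) (β : G₁ →* G₂ →* M) :
    cocycles₂ (Rep.trivial ℤ (G₁ × G₂) (Additive M)) :=
  ⟨fun x => f₁.1 (x.1.1, x.2.1) + f₂.1 (x.1.2, x.2.2) + .ofMul (β x.1.1 x.2.2),
    (mem_cocycles₂_iff _).2 fun g h j => by
      have c₁ := map_mul_add f₁ g.1 h.1 j.1
      have c₂ := map_mul_add f₂ g.2 h.2 j.2
      have b₁ : Additive.ofMul (β (g.1 * h.1) j.2) = .ofMul (β g.1 j.2) + .ofMul (β h.1 j.2) := by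
        rw [map_mul]
        rfl
      have b₂ : Additive.ofMul (β g.1 (h.2 * j.2)) = .ofMul (β g.1 h.2) + .ofMul (β g.1 j.2) := by
        rw [map_mul]
        rfl
      change f₁.1 (g.1 * h.1, j.1) + f₂.1 (g.2 * h.2, j.2) + Additive.ofMul (β (g.1 * h.1) j.2) +
          (f₁.1 (g.1, h.1) + f₂.1 (g.2, h.2) + Additive.ofMul (β g.1 h.2)) =
        f₁.1 (h.1, j.1) + f₂.1 (h.2, j.2) + Additive.ofMul (β h.1 j.2) +
          (f₁.1 (g.1, h.1 * j.1) + f₂.1 (g.2, h.2 * j.2) + Additive.ofMul (β g.1 (h.2 * j.2)))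
      linear_combination (norm := module) c₁ + c₂ + b₁ - b₂⟩

theorem ofFactors_apply (f₁ : cocycles₂ (Rep.trivial ℤ G₁ (Additive M)))
    (f₂ : cocycles₂ (Rep.trivial ℤ G₂ (Additive M))) (β : G₁ →* G₂ →* M) (x y : G₁ × G₂) :
    (ofFactors f₁ f₂ β).1 (x, y) =
      f₁.1 (x.1, y.1) + f₂.1 (x.2, y.2) + .ofMul (β x.1 y.2) := rfl

theorem toH2_comap_inl_ofFactors (f₁ : cocycles₂ (Rep.trivial ℤ G₁ (Additive M)))
    (f₂ : cocycles₂ (Rep.trivial ℤ G₂ (Additive M))) (β : G₁ →* G₂ →* M) :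
    toH2 G₁ (Additive M) (comap (MonoidHom.inl G₁ G₂) (ofFactors f₁ f₂ β)) = toH2 _ _ f₁ := by
  rw [toH2_eq_iff]
  convert const_mem_coboundaries₂ (G := G₁) (f₂.1 (1, 1)) using 1
  refine funext fun ⟨g, g'⟩ => ?_
  change f₁.1 (g, g') + f₂.1 (1, 1) + Additive.ofMul (β g 1) - f₁.1 (g, g') = f₂.1 (1, 1)
  rw [map_one, ofMul_one]
  abel

theorem toH2_comap_inr_ofFactors (f₁ : cocycles₂ (Rep.trivial ℤ G₁ (Additive M)))
    (f₂ : cocycles₂ (Rep.trivial ℤ G₂ (Additive M))) (β : G₁ →* G₂ →* M) :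
    toH2 G₂ (Additive M) (comap (MonoidHom.inr G₁ G₂) (ofFactors f₁ f₂ β)) = toH2 _ _ f₂ := by
  rw [toH2_eq_iff]
  convert const_mem_coboundaries₂ (G := G₂) (f₁.1 (1, 1)) using 1
  refine funext fun ⟨h, h'⟩ => ?_
  change f₁.1 (1, 1) + f₂.1 (h, h') + Additive.ofMul (β 1 h') - f₂.1 (h, h') = f₁.1 (1, 1)
  rw [map_one, MonoidHom.one_apply, ofMul_one]
  abel

theorem pairing_ofFactors (f₁ : cocycles₂ (Rep.trivial ℤ G₁ (Additive M)))
    (f₂ : cocycles₂ (Rep.trivial ℤ G₂ (Additive M))) (β : G₁ →* G₂ →* M) :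
    pairing (ofFactors f₁ f₂ β) = .ofMul β := by
  apply Additive.toMul.injective
  ext g h
  apply Additive.ofMul.injective
  rw [pairing_apply, ofFactors_apply, ofFactors_apply]
  change f₁.1 (g, 1) + f₂.1 (1, h) + Additive.ofMul (β g h) -
    (f₁.1 (1, g) + f₂.1 (h, 1) + Additive.ofMul (β 1 1)) = Additive.ofMul (β g h)
  rw [map_one_left f₁ g, map_one_right f₁ g, map_one_left f₂ h, map_one_right f₂ h, map_one,
    ofMul_one]
  abel

/-- Restriction of a 2-cocycle on a direct product to the cohomology of both factors, together
with the induced pairing. -/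
noncomputable def toFactors (G₁ G₂ M : Type) [Group G₁] [Group G₂] [CommGroup M] :
    cocycles₂ (Rep.trivial ℤ (G₁ × G₂) (Additive M)) →+
      groupCohomology (Rep.trivial ℤ G₁ (Additive M)) 2 ×
        groupCohomology (Rep.trivial ℤ G₂ (Additive M)) 2 × Additive (G₁ →* G₂ →* M) :=
  ((toH2 G₁ (Additive M)).comp (comap (MonoidHom.inl G₁ G₂))).prod
    (((toH2 G₂ (Additive M)).comp (comap (MonoidHom.inr G₁ G₂))).prod pairing)

theorem toFactors_apply (f : cocycles₂ (Rep.trivial ℤ (G₁ × G₂) (Additive M))) :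
    toFactors G₁ G₂ M f = (toH2 G₁ (Additive M) (comap (MonoidHom.inl G₁ G₂) f),
      toH2 G₂ (Additive M) (comap (MonoidHom.inr G₁ G₂) f), pairing f) := rfl

theorem toFactors_surjective : Function.Surjective (toFactors G₁ G₂ M) := by
  rintro ⟨x₁, x₂, β⟩
  obtain ⟨f₁, rfl⟩ := toH2_surjective x₁
  obtain ⟨f₂, rfl⟩ := toH2_surjective x₂
  refine ⟨ofFactors f₁ f₂ β.toMul, ?_⟩
  rw [toFactors_apply, toH2_comap_inl_ofFactors, toH2_comap_inr_ofFactors, pairing_ofFactors]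
  rfl

theorem ker_toH2_eq_ker_toFactors :
    (toH2 (G₁ × G₂) (Additive M)).ker = (toFactors G₁ G₂ M).ker := by
  ext f
  rw [AddMonoidHom.mem_ker, AddMonoidHom.mem_ker, toH2_eq_zero_iff, toFactors_apply,
    Prod.mk_eq_zero, Prod.mk_eq_zero, toH2_eq_zero_iff, toH2_eq_zero_iff]
  exact ⟨fun hf => ⟨comap_mem_coboundaries₂ _ hf, comap_mem_coboundaries₂ _ hf,
    pairing_eq_zero_of_mem_coboundaries₂ hf⟩,
    fun ⟨h₁, h₂, h⟩ => mem_coboundaries₂_of_restrict h₁ h₂ h⟩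

/-- The Künneth decomposition of the second cohomology of a direct product with trivial
coefficients. -/
noncomputable def h2ProdEquiv (G₁ G₂ M : Type) [Group G₁] [Group G₂] [CommGroup M] :
    groupCohomology (Rep.trivial ℤ (G₁ × G₂) (Additive M)) 2 ≃+
      groupCohomology (Rep.trivial ℤ G₁ (Additive M)) 2 ×
        groupCohomology (Rep.trivial ℤ G₂ (Additive M)) 2 × Additive (G₁ →* G₂ →* M) :=
  (QuotientAddGroup.quotientKerEquivOfSurjective _ toH2_surjective).symm.trans <|
    (QuotientAddGroup.quotientAddEquivOfEq ker_toH2_eq_ker_toFactors).trans <|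
      QuotientAddGroup.quotientKerEquivOfSurjective _ toFactors_surjective

end TrivialCocycle

/-- The universal property of the abelianization, as an isomorphism of groups of homomorphisms. -/
def Abelianization.liftMulEquiv (G M : Type*) [Group G] [CommGroup M] :
    (G →* M) ≃* (Abelianization G →* M) :=
  { Abelianization.lift with
    map_mul' := fun f f' => by
      ext
      rfl }

theorem nonempty_pairing_mulEquiv (G₁ G₂ : Type*) [Group G₁] [Group G₂] [Finite G₂] :
    Nonempty ((G₁ →* G₂ →* ℂˣ) ≃* (Abelianization G₁ →* Abelianization G₂)) := by
  have : Finite (Abelianization G₂) := Quotient.finite _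
  have : NeZero (Monoid.exponent (Abelianization G₂)) := ⟨Monoid.exponent_ne_zero_of_finite⟩
  obtain ⟨e⟩ := CommGroup.monoidHom_mulEquiv_of_hasEnoughRootsOfUnity (Abelianization G₂) ℂ
  exact ⟨(Abelianization.liftMulEquiv G₁ (G₂ →* ℂˣ)).trans
    (MulEquiv.monoidHomCongrRight ((Abelianization.liftMulEquiv G₂ ℂˣ).trans e))⟩

/-- For finite groups `G₁` and `G₂`, the Schur multiplier `M(G) := H²(G; ℂˣ)` (second
group cohomology with coefficients in `ℂˣ` with the trivial action) of the direct
product satisfies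
`M(G₁ × G₂) ≅ M(G₁) × M(G₂) × Hom(G₁/G₁', G₂/G₂')`
as abelian groups, where the last factor is the group of homomorphisms between the
abelianizations. -/
theorem schur_multiplier_prod (G₁ G₂ : Type) [Group G₁] [Group G₂]
    [Finite G₁] [Finite G₂] :
    Nonempty
      (groupCohomology (Rep.trivial ℤ (G₁ × G₂) (Additive ℂˣ)) 2 ≃+
        (groupCohomology (Rep.trivial ℤ G₁ (Additive ℂˣ)) 2 ×
          groupCohomology (Rep.trivial ℤ G₂ (Additive ℂˣ)) 2 ×
            Additive (Abelianization G₁ →* Abelianization G₂))) := by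
  obtain ⟨e⟩ := nonempty_pairing_mulEquiv G₁ G₂
  exact ⟨(TrivialCocycle.h2ProdEquiv G₁ G₂ ℂˣ).trans
    ((AddEquiv.refl _).prodCongr ((AddEquiv.refl _).prodCongr (MulEquiv.toAdditive e)))⟩
end
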